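/- arXiv:1807.08779 — 3 statements merged into one kernel-verified Lean document; each statement's English description precedes it below -/
import Mathlib

section
/- Let $v \in \mathbb{C}^{d_1}$ with $\|v\|_2 = 1$, let $d_2 < d_1$ with $d_2$ dividing $d_1$, fix a block index $j$ with $1 \leq j \leq d_1/d_2$, and let $m$ be a positive integer. Let $V_1, \ldots, V_s$ be $d_1 \times d_1$ unitary matrices forming a $(d_1, s, \lambda, 2m)$-tensor product expander. Define $g(U) := \|\Pi_j U v\|_2^2 - \frac{d_2}{d_1}$. Then $\left| \frac{1}{s}\sum_{i=1}^s (g(V_i))^{2m} - \mathbb{E}_{U \sim \mathrm{Haar}}\left[(g(U))^{2m}\right] \right| \leq d_2^m \lambda$. -/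
open MeasureTheory Matrix

noncomputable section

/-- The Borel/product measurable structure on matrices over `ℂ`. -/
instance {d : ℕ} : MeasurableSpace (Matrix (Fin d) (Fin d) ℂ) :=
  inferInstanceAs (MeasurableSpace (Fin d → Fin d → ℂ))

/-- The Euclidean (`ℓ₂`) norm of a vector in `ℂ^d`. -/
def l2norm {d : ℕ} (v : Fin d → ℂ) : ℝ := Real.sqrt (∑ a, ‖v a‖ ^ 2)

/-- The Frobenius (Hilbert–Schmidt, Schatten 2) norm of a square matrix over `ℂ`. -/
def frobNorm {m : Type*} [Fintype m] (M : Matrix m m ℂ) : ℝ :=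
  Real.sqrt (∑ a, ∑ b, ‖M a b‖ ^ 2)

/-- The orthogonal projection of `ℂ^{d₁}` onto the (0-indexed) `j`-th consecutive block of
`d₂` coordinates. -/
def blockProj (d1 d2 j : ℕ) : Matrix (Fin d1) (Fin d1) ℂ :=
  Matrix.diagonal fun a => if a.val / d2 = j then 1 else 0

/-- The `t`-fold tensor (Kronecker) power of a `d × d` matrix, as a matrix indexed by
`Fin t → Fin d`. -/
def tpow {d : ℕ} (M : Matrix (Fin d) (Fin d) ℂ) (t : ℕ) :
    Matrix (Fin t → Fin d) (Fin t → Fin d) ℂ :=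
  Matrix.of fun a b => ∏ k, M (a k) (b k)

/-- The conjugation action `M ↦ U^{⊗t} M (U†)^{⊗t}`. -/
def conjAct {d : ℕ} (t : ℕ) (U : Matrix (Fin d) (Fin d) ℂ)
    (M : Matrix (Fin t → Fin d) (Fin t → Fin d) ℂ) :
    Matrix (Fin t → Fin d) (Fin t → Fin d) ℂ :=
  tpow U t * M * tpow Uᴴ t

/-- The (entrywise) expectation `𝔼_{U ~ μ} [U^{⊗t} M (U†)^{⊗t}]` over a measure `μ` on the
unitary group. -/
def haarAvg {d : ℕ} (μ : Measure (Matrix.unitaryGroup (Fin d) ℂ)) (t : ℕ)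
    (M : Matrix (Fin t → Fin d) (Fin t → Fin d) ℂ) :
    Matrix (Fin t → Fin d) (Fin t → Fin d) ℂ :=
  Matrix.of fun a b => ∫ U, conjAct t (U : Matrix (Fin d) (Fin d) ℂ) M a b ∂μ

/-- `V : ι → U(d)` (with `s = |ι|` unitaries) is a `(d, s, λ, t)`-tensor product expander
with respect to the Haar measure `μ`: for every operator `M` on `(ℂ^d)^{⊗t}`,
`‖s⁻¹ ∑ᵢ Vᵢ^{⊗t} M (Vᵢ†)^{⊗t} − 𝔼_Haar[U^{⊗t} M (U†)^{⊗t}]‖₂ ≤ λ ‖M‖₂`. -/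
def IsTPE {d : ℕ} {ι : Type*} [Fintype ι]
    (μ : Measure (Matrix.unitaryGroup (Fin d) ℂ)) (t : ℕ) (lam : ℝ)
    (V : ι → Matrix.unitaryGroup (Fin d) ℂ) : Prop :=
  ∀ M : Matrix (Fin t → Fin d) (Fin t → Fin d) ℂ,
    frobNorm ((Fintype.card ι : ℂ)⁻¹ •
        (∑ i, conjAct t ((V i : Matrix (Fin d) (Fin d) ℂ)) M) - haarAvg μ t M)
      ≤ lam * frobNorm M


/-- The tensor power of the rank one operator `v v†`. -/
def rankOnePow {d : ℕ} (v : Fin d → ℂ) (t : ℕ) :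
    Matrix (Fin t → Fin d) (Fin t → Fin d) ℂ :=
  Matrix.of fun a b => ∏ k, (v (a k) * star (v (b k)))

lemma sum_prod_pow {R : Type*} [CommSemiring R] {d t : ℕ} (f : Fin d → R) :
    ∑ a : Fin t → Fin d, ∏ k, f (a k) = (∑ i, f i) ^ t := by
  rw [Finset.sum_pow', Fintype.piFinset_univ]

lemma conjAct_rankOne {d : ℕ} (t : ℕ) (U : Matrix (Fin d) (Fin d) ℂ) (v : Fin d → ℂ)
    (a b : Fin t → Fin d) :
    conjAct t U (rankOnePow v t) a b = ∏ k, (U.mulVec v (a k) * star (U.mulVec v (b k))) := by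
  have h1 : ∀ a : Fin t → Fin d, ∏ k, U.mulVec v (a k)
      = ∑ x : Fin t → Fin d, ∏ k, (U (a k) (x k) * v (x k)) := by
    intro a
    simp only [Matrix.mulVec, dotProduct]
    rw [Finset.prod_univ_sum, Fintype.piFinset_univ]
  rw [Finset.prod_mul_distrib]
  have h2 : ∏ k, star (U.mulVec v (b k))
      = ∑ x : Fin t → Fin d, ∏ k, star (U (b k) (x k) * v (x k)) := by
    have := congrArg star (h1 b)
    simpa [star_sum, star_prod] using this
  rw [h1, h2, conjAct, Matrix.mul_apply, Finset.sum_mul_sum, Finset.sum_comm]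
  refine Finset.sum_congr rfl fun y _ => ?_
  rw [Matrix.mul_apply, Finset.sum_mul]
  refine Finset.sum_congr rfl fun x _ => ?_
  simp only [tpow, rankOnePow, Matrix.of_apply, Matrix.conjTranspose_apply,
    ← Finset.prod_mul_distrib]
  refine Finset.prod_congr rfl fun k _ => ?_
  rw [star_mul]
  ring

lemma frobNorm_rankOne {d : ℕ} (t : ℕ) (v : Fin d → ℂ) (hv : ∑ a, ‖v a‖ ^ 2 = 1) :
    frobNorm (rankOnePow v t) = 1 := by
  unfold frobNorm
  have : ∑ a, ∑ b, ‖rankOnePow v t a b‖ ^ 2 = 1 := by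
    have h : ∀ a b, ‖rankOnePow v t a b‖ ^ 2 = (∏ k, ‖v (a k)‖ ^ 2) * ∏ k, ‖v (b k)‖ ^ 2 := by
      intro a b
      simp [rankOnePow, norm_prod, ← Finset.prod_pow, mul_pow, Finset.prod_mul_distrib]
    simp_rw [h]
    rw [← Finset.sum_mul_sum, sum_prod_pow (fun i => ‖v i‖ ^ 2), hv]
    simp
  rw [this, Real.sqrt_one]

lemma unitary_mulVec_norm {d : ℕ} (U : Matrix.unitaryGroup (Fin d) ℂ) (v : Fin d → ℂ) :
    ∑ a, ‖(U : Matrix (Fin d) (Fin d) ℂ).mulVec v a‖ ^ 2 = ∑ a, ‖v a‖ ^ 2 := by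
  have key : ∀ w : Fin d → ℂ, star w ⬝ᵥ w = ((∑ a, ‖w a‖ ^ 2 : ℝ) : ℂ) := by
    intro w
    simp only [dotProduct, Pi.star_apply, Complex.ofReal_sum]
    refine Finset.sum_congr rfl fun a _ => ?_
    have := Complex.conj_mul' (w a)
    simpa using this
  have hU : (U : Matrix (Fin d) (Fin d) ℂ)ᴴ * (U : Matrix (Fin d) (Fin d) ℂ) = 1 := by
    have := Matrix.UnitaryGroup.star_mul_self U
    simpa [Matrix.star_eq_conjTranspose] using this
  apply Complex.ofReal_injective
  rw [← key, ← key, Matrix.star_mulVec, Matrix.dotProduct_mulVec, Matrix.vecMul_vecMul, hU,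
    Matrix.vecMul_one]

lemma measurable_entry {d : ℕ} (v : Fin d → ℂ) (a : Fin d) :
    Measurable fun U : Matrix.unitaryGroup (Fin d) ℂ =>
      (U : Matrix (Fin d) (Fin d) ℂ).mulVec v a := by
  have h : ∀ b, Measurable fun U : Matrix.unitaryGroup (Fin d) ℂ =>
      (U : Matrix (Fin d) (Fin d) ℂ) a b := fun b =>
    (measurable_pi_apply b).comp ((measurable_pi_apply a).comp measurable_subtype_coe)
  simp only [Matrix.mulVec, dotProduct]
  exact Finset.measurable_sum _ fun b _ => (h b).mul_const _

lemma integrable_conjAct {d : ℕ} (t : ℕ) (v : Fin d → ℂ) (hv : ∑ a, ‖v a‖ ^ 2 = 1)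
    (μ : Measure (Matrix.unitaryGroup (Fin d) ℂ)) [IsProbabilityMeasure μ]
    (a b : Fin t → Fin d) :
    Integrable (fun U : Matrix.unitaryGroup (Fin d) ℂ =>
      conjAct t (U : Matrix (Fin d) (Fin d) ℂ) (rankOnePow v t) a b) μ := by
  simp_rw [conjAct_rankOne]
  have hb : ∀ (U : Matrix.unitaryGroup (Fin d) ℂ) i,
      ‖(U : Matrix (Fin d) (Fin d) ℂ).mulVec v i‖ ≤ 1 := by
    intro U i
    have h1 := unitary_mulVec_norm U v
    rw [hv] at h1
    have h2 := Finset.single_le_sum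
      (f := fun a => ‖(U : Matrix (Fin d) (Fin d) ℂ).mulVec v a‖ ^ 2)
      (fun a _ => by positivity) (Finset.mem_univ i)
    rw [h1] at h2
    exact (sq_le_one_iff₀ (norm_nonneg _)).1 h2
  refine Integrable.of_bound (C := 1) ?_ ?_
  · refine Measurable.aestronglyMeasurable ?_
    refine Finset.measurable_prod _ fun k _ => ?_
    exact (measurable_entry v _).mul
      (Complex.continuous_conj.measurable.comp (measurable_entry v _))
  · refine Filter.Eventually.of_forall fun U => ?_
    rw [norm_prod]
    refine Finset.prod_le_one (fun _ _ => norm_nonneg _) fun k _ => ?_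
    rw [norm_mul, norm_star]
    exact mul_le_one₀ (hb U _) (norm_nonneg _) (hb U _)

/-- The diagonal of `Π_j - (d₂/d₁) I`. -/
def alpha (d1 d2 j : ℕ) (a : Fin d1) : ℝ :=
  (if a.val / d2 = j then 1 else 0) - (d2 : ℝ) / d1

lemma block_count (d1 d2 j : ℕ) (hdvd : d2 ∣ d1) (hj : j < d1 / d2) :
    ∑ a : Fin d1, (if a.val / d2 = j then (1 : ℝ) else 0) = d2 := by
  have hd2 : 0 < d2 := by
    rcases Nat.eq_zero_or_pos d2 with h | h
    · simp [h] at hj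
    · exact h
  rw [Fin.sum_univ_eq_sum_range (fun a => if a / d2 = j then (1 : ℝ) else 0) d1,
    ← Finset.sum_filter]
  have : Finset.filter (fun a => a / d2 = j) (Finset.range d1)
      = Finset.Ico (j * d2) ((j + 1) * d2) := by
    ext a
    have h3 : (j + 1) * d2 ≤ d1 := by
      calc (j + 1) * d2 ≤ (d1 / d2) * d2 := Nat.mul_le_mul_right _ hj
        _ = d1 := Nat.div_mul_cancel hdvd
    simp only [Finset.mem_filter, Finset.mem_range, Finset.mem_Ico]
    rw [Nat.div_eq_iff hd2]
    constructor
    · rintro ⟨_, h⟩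
      rw [add_mul]
      omega
    · rintro ⟨h, h'⟩
      refine ⟨by omega, h, ?_⟩
      rw [add_mul] at h'
      omega
  rw [this]
  simp [add_mul]

lemma alpha_sq (d1 d2 j : ℕ) (hd : d2 < d1) (hdvd : d2 ∣ d1) (hj : j < d1 / d2) :
    ∑ a, alpha d1 d2 j a ^ 2 ≤ d2 := by
  have h : ∀ a, alpha d1 d2 j a ^ 2
      = (if a.val / d2 = j then (1 : ℝ) else 0) * (1 - 2 * ((d2 : ℝ) / d1))
        + ((d2 : ℝ) / d1) ^ 2 := by
    intro a
    unfold alpha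
    split_ifs <;> ring
  simp_rw [h]
  rw [Finset.sum_add_distrib, ← Finset.sum_mul, block_count d1 d2 j hdvd hj]
  have h0 : (0 : ℝ) < d1 := by exact_mod_cast (Nat.zero_le _).trans_lt hd
  have : ∑ _a : Fin d1, ((d2 : ℝ) / d1) ^ 2 = d2 * ((d2 : ℝ) / d1) := by
    simp
    field_simp
  rw [this]
  have : 0 ≤ (d2 : ℝ) * ((d2 : ℝ) / d1) := by positivity
  linarith

lemma g_eq (d1 d2 j : ℕ) (w : Fin d1 → ℂ) (hw : ∑ a, ‖w a‖ ^ 2 = 1) :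
    l2norm ((blockProj d1 d2 j).mulVec w) ^ 2 - (d2 : ℝ) / d1
      = ∑ a, alpha d1 d2 j a * ‖w a‖ ^ 2 := by
  unfold l2norm
  rw [Real.sq_sqrt (Finset.sum_nonneg fun _ _ => by positivity)]
  simp only [alpha, sub_mul, Finset.sum_sub_distrib, ← Finset.mul_sum, hw, mul_one]
  congr 1
  refine Finset.sum_congr rfl fun a _ => ?_
  rw [blockProj, Matrix.mulVec_diagonal]
  split_ifs <;> simp

lemma g_pow (d1 d2 j t : ℕ) (v : Fin d1 → ℂ) (hv : ∑ a, ‖v a‖ ^ 2 = 1)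
    (U : Matrix.unitaryGroup (Fin d1) ℂ) :
    (((l2norm ((blockProj d1 d2 j).mulVec ((U : Matrix (Fin d1) (Fin d1) ℂ).mulVec v)) ^ 2 -
      (d2 : ℝ) / d1) ^ t : ℝ) : ℂ)
      = ∑ a : Fin t → Fin d1, ((∏ k, alpha d1 d2 j (a k) : ℝ) : ℂ) *
        conjAct t (U : Matrix (Fin d1) (Fin d1) ℂ) (rankOnePow v t) a a := by
  rw [g_eq _ _ _ _ ((unitary_mulVec_norm U v).trans hv), ← sum_prod_pow, Complex.ofReal_sum]
  refine Finset.sum_congr rfl fun a _ => ?_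
  rw [conjAct_rankOne, Finset.prod_mul_distrib, Complex.ofReal_mul]
  congr 1
  rw [Complex.ofReal_prod]
  refine Finset.prod_congr rfl fun k _ => ?_
  have := Complex.mul_conj' ((U : Matrix (Fin d1) (Fin d1) ℂ).mulVec v (a k))
  simpa using this.symm

lemma diag_cs {n : Type*} [Fintype n] (β : n → ℝ) (D : Matrix n n ℂ) :
    ‖∑ a, ((β a : ℝ) : ℂ) * D a a‖ ≤ Real.sqrt (∑ a, β a ^ 2) * frobNorm D := by
  calc ‖∑ a, ((β a : ℝ) : ℂ) * D a a‖ ≤ ∑ a, |β a| * ‖D a a‖ := by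
        refine (norm_sum_le _ _).trans (le_of_eq ?_)
        simp
    _ ≤ Real.sqrt (∑ a, |β a| ^ 2) * Real.sqrt (∑ a, ‖D a a‖ ^ 2) :=
        Real.sum_mul_le_sqrt_mul_sqrt _ _ _
    _ ≤ _ := by
        simp only [sq_abs]
        refine mul_le_mul_of_nonneg_left ?_ (Real.sqrt_nonneg _)
        refine Real.sqrt_le_sqrt (Finset.sum_le_sum fun a _ => ?_)
        exact Finset.single_le_sum (f := fun b => ‖D a b‖ ^ 2)
          (fun _ _ => by positivity) (Finset.mem_univ a)

/-- **A TPE fools the `2m`-th moment of `g(U) = ‖Π_j U v‖₂² − d₂/d₁`:** if `V₁, ..., Vₛ`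
form a `(d₁, s, λ, 2m)`-TPE, then the design average of `g^{2m}` is within `d₂^m λ` of its
Haar average. -/
theorem tpe_moment_close_to_haar
    (d1 d2 : ℕ) (hd : d2 < d1) (hdvd : d2 ∣ d1)
    (v : Fin d1 → ℂ) (hv : l2norm v = 1)
    (j : ℕ) (hj : j < d1 / d2)
    (m : ℕ) (hm : 0 < m)
    (μ : Measure (Matrix.unitaryGroup (Fin d1) ℂ)) [IsProbabilityMeasure μ]
    (hinv : ∀ V : Matrix.unitaryGroup (Fin d1) ℂ, μ.map (fun U => V * U) = μ)
    (s : ℕ) (lam : ℝ) (V : Fin s → Matrix.unitaryGroup (Fin d1) ℂ)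
    (hV : IsTPE μ (2 * m) lam V) :
    |(s : ℝ)⁻¹ * ∑ k : Fin s,
        (l2norm ((blockProj d1 d2 j).mulVec ((V k : Matrix (Fin d1) (Fin d1) ℂ).mulVec v)) ^ 2 -
          (d2 : ℝ) / d1) ^ (2 * m) -
      ∫ U : Matrix.unitaryGroup (Fin d1) ℂ,
        (l2norm ((blockProj d1 d2 j).mulVec ((U : Matrix (Fin d1) (Fin d1) ℂ).mulVec v)) ^ 2 -
          (d2 : ℝ) / d1) ^ (2 * m) ∂μ|
      ≤ (d2 : ℝ) ^ m * lam := by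
  have hv' : ∑ a, ‖v a‖ ^ 2 = 1 := by
    unfold l2norm at hv
    rwa [Real.sqrt_eq_one] at hv
  have hM := hV (rankOnePow v (2 * m))
  rw [frobNorm_rankOne _ v hv', mul_one] at hM
  set D := (Fintype.card (Fin s) : ℂ)⁻¹ •
        (∑ i, conjAct (2 * m) ((V i : Matrix (Fin d1) (Fin d1) ℂ)) (rankOnePow v (2 * m)))
          - haarAvg μ (2 * m) (rankOnePow v (2 * m)) with hD
  set β : (Fin (2 * m) → Fin d1) → ℝ := fun a => ∏ k, alpha d1 d2 j (a k) with hβ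
  have hβ2 : Real.sqrt (∑ a, β a ^ 2) ≤ (d2 : ℝ) ^ m := by
    have h1 : ∑ a, β a ^ 2 = ((∑ i, alpha d1 d2 j i ^ 2) ^ m) ^ 2 := by
      rw [← pow_mul, mul_comm m 2, ← sum_prod_pow]
      simp [hβ, Finset.prod_pow]
    have h0 : 0 ≤ ∑ i, alpha d1 d2 j i ^ 2 := Finset.sum_nonneg fun _ _ => sq_nonneg _
    rw [h1, Real.sqrt_sq (pow_nonneg h0 _)]
    exact pow_le_pow_left₀ h0 (alpha_sq d1 d2 j hd hdvd hj) m
  have hfn : 0 ≤ frobNorm D := Real.sqrt_nonneg _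
  rw [← Real.norm_eq_abs, ← Complex.norm_real]
  refine le_trans (le_of_eq ?_) ((diag_cs β D).trans
    (mul_le_mul hβ2 hM hfn (by positivity)))
  congr 1
  rw [Complex.ofReal_sub, Complex.ofReal_mul, Complex.ofReal_sum, ← integral_complex_ofReal]
  simp_rw [g_pow d1 d2 j (2 * m) v hv']
  rw [integral_finset_sum _ fun a _ => (integrable_conjAct (2 * m) v hv' μ a a).const_mul _]
  simp_rw [integral_const_mul]
  rw [Finset.sum_comm, Finset.mul_sum, ← Finset.sum_sub_distrib]
  refine Finset.sum_congr rfl fun a _ => ?_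
  simp only [hD, haarAvg, Matrix.sub_apply, Matrix.smul_apply, Matrix.sum_apply, Matrix.of_apply,
    Fintype.card_fin, smul_eq_mul, ← Finset.mul_sum, Complex.ofReal_inv, Complex.ofReal_natCast, hβ]
  ring
end
end

section
/- Let $v \in \mathbb{C}^{d_1}$ with $\|v\|_2 = 1$, let $d_2 < d_1$ with $d_2$ dividing $d_1$, let $0 < \epsilon < 1$, and suppose $m := 2^{-10}\epsilon^2 d_2$ is a positive integer. Let $V_1, \ldots, V_s$ be $d_1 \times d_1$ unitary matrices forming a $(d_1, s, \lambda, 2m)$-tensor product expander with $\lambda \leq \left(\frac{4\epsilon^2 d_2}{d_1^2}\right)^{m} e^{-m}$. Then for any fixed block index $i$ with $1 \leq i \leq d_1/d_2$, if $U$ is chosen uniformly at random from $\{V_1, \ldots, V_s\}$, $\Pr_U\left[\|\Pi_i U v\|_2 \notin [(1-\epsilon)\sqrt{d_2/d_1},\, (1+\epsilon)\sqrt{d_2/d_1}]\right] \leq 2^6 \exp(-2^{-10}\epsilon^2 d_2)$. -/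
open MeasureTheory Matrix

noncomputable section

/-! ### Gaussian computations -/

theorem aux_lintegral_prod {d : ℕ} (f : Fin d → ℂ → ℝ) (hf : ∀ j z, 0 ≤ f j z)
    (hpos : ∀ j, 0 < ∫ z, f j z) :
    ∫⁻ z : Fin d → ℂ, ENNReal.ofReal (∏ j, f j (z j)) = ENNReal.ofReal (∏ j, ∫ z, f j z) := by
  rw [← integral_fintype_prod_volume_eq_prod]
  rw [ofReal_integral_eq_lintegral_ofReal]
  · apply Integrable.of_integral_ne_zero
    rw [integral_fintype_prod_volume_eq_prod]
    exact (Finset.prod_pos fun j _ => hpos j).ne'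
  · exact Filter.Eventually.of_forall fun z => Finset.prod_nonneg fun j _ => hf j _

theorem aux_gauss1 {b : ℝ} (hb : 0 < b) :
    ∫ z : ℂ, Real.exp (-b * ‖z‖ ^ 2) = Real.pi / b := by
  have h := Complex.integral_exp_neg_mul_rpow (p := 2) (b := b) (by norm_num) hb
  have h2 : (-2 / 2 : ℝ) = -1 := by norm_num
  have h3 : (2 / 2 + 1 : ℝ) = 2 := by norm_num
  rw [h2, h3, Real.Gamma_two, Real.rpow_neg_one] at h
  simp only [Real.rpow_two] at h
  rw [h]; field_simp

theorem aux_gauss2 :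
    ∫ z : ℂ, ‖z‖ ^ 2 * Real.exp (-‖z‖ ^ 2) = Real.pi := by
  have h := Complex.integral_rpow_mul_exp_neg_rpow (p := 2) (q := 2) (by norm_num) (by norm_num)
  have h3 : ((2 + 2) / 2 : ℝ) = 2 := by norm_num
  rw [h3, Real.Gamma_two] at h
  simp only [Real.rpow_two] at h
  rw [h]; field_simp

/-- squared Euclidean norm -/
def nsq {d : ℕ} (z : Fin d → ℂ) : ℝ := ∑ j, ‖z j‖ ^ 2

theorem nsq_nonneg {d : ℕ} (z : Fin d → ℂ) : 0 ≤ nsq z :=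
  Finset.sum_nonneg fun _ _ => by positivity

theorem aux_exp_quad {d : ℕ} (a : Fin d → ℝ) (ha : ∀ j, a j < 1) :
    ∫⁻ z : Fin d → ℂ, ENNReal.ofReal (Real.exp (∑ j, a j * ‖z j‖ ^ 2) * Real.exp (- nsq z))
      = ENNReal.ofReal (∏ j, Real.pi / (1 - a j)) := by
  have h := aux_lintegral_prod (d := d) (fun j z => Real.exp (-(1 - a j) * ‖z‖ ^ 2))
    (fun j z => (Real.exp_pos _).le)
    (fun j => by
      rw [aux_gauss1 (by linarith [ha j])]
      have := ha j
      have : 0 < 1 - a j := by linarith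
      positivity)
  rw [Finset.prod_congr rfl fun j _ => aux_gauss1 (b := 1 - a j) (by linarith [ha j])] at h
  rw [← h]
  congr 1; ext z
  rw [← Real.exp_add, ← Real.exp_sum, nsq, ← Finset.sum_neg_distrib, ← Finset.sum_add_distrib]
  congr 2
  exact Finset.sum_congr rfl fun j _ => by ring

theorem aux_mass (d : ℕ) :
    ∫⁻ z : Fin d → ℂ, ENNReal.ofReal (Real.exp (- nsq z)) = ENNReal.ofReal (Real.pi ^ d) := by
  have := aux_exp_quad (d := d) (fun _ => 0) (by simp)
  simpa using this

theorem aux_first (d : ℕ) :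
    ∫⁻ z : Fin d → ℂ, ENNReal.ofReal (nsq z * Real.exp (- nsq z))
      = ENNReal.ofReal (d * Real.pi ^ d) := by
  have key : ∀ i : Fin d, ∫⁻ z : Fin d → ℂ, ENNReal.ofReal (‖z i‖ ^ 2 * Real.exp (- nsq z))
      = ENNReal.ofReal (Real.pi ^ d) := by
    intro i
    have hI : ∀ j : Fin d, ∫ z : ℂ, (if j = i then ‖z‖ ^ 2 else 1) * Real.exp (-‖z‖ ^ 2)
        = Real.pi := by
      intro j
      by_cases hj : j = i
      · simp only [hj, if_true]; exact aux_gauss2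
      · simp only [hj, if_false]
        have := aux_gauss1 (b := 1) one_pos
        simpa using this
    have h := aux_lintegral_prod (d := d)
      (fun j z => (if j = i then ‖z‖ ^ 2 else 1) * Real.exp (-‖z‖ ^ 2))
      (fun j z => by split_ifs <;> positivity)
      (fun j => by rw [hI]; exact Real.pi_pos)
    simp only [hI, Finset.prod_const, Finset.card_univ, Fintype.card_fin] at h
    rw [← h]
    congr 1; ext z
    rw [Finset.prod_mul_distrib, ← Real.exp_sum, Finset.prod_ite_eq' ]
    simp [nsq]
  have : ∀ z : Fin d → ℂ, ENNReal.ofReal (nsq z * Real.exp (- nsq z))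
      = ∑ i, ENNReal.ofReal (‖z i‖ ^ 2 * Real.exp (- nsq z)) := by
    intro z
    rw [← ENNReal.ofReal_sum_of_nonneg (fun _ _ => by positivity), ← Finset.sum_mul, nsq]
  simp only [this]
  rw [lintegral_finsetSum]
  · simp only [key, Finset.sum_const, Finset.card_univ, Fintype.card_fin, nsmul_eq_mul]
    rw [ENNReal.ofReal_mul (by positivity), ENNReal.ofReal_natCast]
  · intro i _
    unfold nsq
    fun_prop

theorem aux_norm_moment (d k : ℕ) (hd : 0 < d) (hk : 0 < k) :
    ENNReal.ofReal ((d : ℝ) ^ k * Real.pi ^ d) ≤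
    ∫⁻ z : Fin d → ℂ, ENNReal.ofReal (nsq z ^ k * Real.exp (- nsq z)) := by
  have hd' : (0 : ℝ) < d := by exact_mod_cast hd
  have hk' : (1 : ℝ) ≤ k := by exact_mod_cast hk
  have hpt : ∀ x : ℝ, 0 ≤ x → k * (d : ℝ) ^ (k - 1) * x ≤ x ^ k + (k - 1) * (d : ℝ) ^ k := by
    intro x hx
    have hx' : 0 ≤ x / d := by positivity
    have := one_add_mul_le_pow (a := x / d - 1) (by linarith) k
    have h1 : (1 + (x / d - 1)) = x / d := by ring
    rw [h1, div_pow] at this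
    have hdk : (d : ℝ) ^ k = d * (d : ℝ) ^ (k - 1) := by
      rw [← pow_succ', Nat.sub_add_cancel hk]
    have h2 := mul_le_mul_of_nonneg_left this (by positivity : 0 ≤ (d : ℝ) ^ k)
    rw [mul_div_cancel₀ _ (by positivity)] at h2
    have h3 : (d : ℝ) ^ k * (1 + k * (x / d - 1))
        = k * (d : ℝ) ^ (k - 1) * x - (k - 1) * (d : ℝ) ^ k := by
      rw [hdk]; field_simp; ring
    linarith
  have hle : ∫⁻ z : Fin d → ℂ, ENNReal.ofReal (k * (d : ℝ) ^ (k - 1)) *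
        ENNReal.ofReal (nsq z * Real.exp (- nsq z)) ≤
      ∫⁻ z : Fin d → ℂ, (ENNReal.ofReal (nsq z ^ k * Real.exp (- nsq z)) +
        ENNReal.ofReal ((k - 1) * (d : ℝ) ^ k) * ENNReal.ofReal (Real.exp (- nsq z))) := by
    apply lintegral_mono
    intro z
    simp only
    have h0 : (0 : ℝ) ≤ (k - 1) * (d : ℝ) ^ k := mul_nonneg (by linarith) (by positivity)
    have hn := nsq_nonneg z
    rw [← ENNReal.ofReal_mul (by positivity), ← ENNReal.ofReal_mul h0,
      ← ENNReal.ofReal_add (by positivity) (mul_nonneg h0 (Real.exp_pos _).le)]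
    apply ENNReal.ofReal_le_ofReal
    have := mul_le_mul_of_nonneg_right (hpt (nsq z) hn) (Real.exp_pos (- nsq z)).le
    linarith
  have h0 : (0 : ℝ) ≤ (k - 1) * (d : ℝ) ^ k := mul_nonneg (by linarith) (by positivity)
  rw [lintegral_const_mul' _ _ ENNReal.ofReal_ne_top, aux_first, lintegral_add_right' _ (by
    unfold nsq; exact Measurable.aemeasurable (Measurable.const_mul (by fun_prop) _)), lintegral_const_mul' _ _ ENNReal.ofReal_ne_top, aux_mass,
    ← ENNReal.ofReal_mul (by positivity), ← ENNReal.ofReal_mul h0] at hle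
  have hdk : (d : ℝ) ^ k = d * (d : ℝ) ^ (k - 1) := by
      rw [← pow_succ', Nat.sub_add_cancel hk]
  have heq : (k * (d : ℝ) ^ (k - 1) * (d * Real.pi ^ d)) =
      (d : ℝ) ^ k * Real.pi ^ d + (k - 1) * (d : ℝ) ^ k * Real.pi ^ d := by
    rw [hdk]; ring
  rw [heq, ENNReal.ofReal_add (by positivity) (mul_nonneg h0 (by positivity))] at hle
  exact (ENNReal.add_le_add_iff_right ENNReal.ofReal_ne_top).1 hle

theorem aux_inv_le {x : ℝ} (hx : |x| ≤ 1 / 2) : 1 / (1 - x) ≤ Real.exp (x + 2 * x ^ 2) := by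
  obtain ⟨h1, h2⟩ := abs_le.1 hx
  have hpos : 0 < 1 - x := by linarith
  have h := Real.abs_log_sub_add_sum_range_le (x := x) (by linarith) 1
  simp only [Finset.range_one, Finset.sum_singleton, zero_add, pow_one, Nat.cast_zero, div_one,
    Nat.reduceAdd, sq_abs] at h
  have h3 : x ^ 2 / (1 - |x|) ≤ 2 * x ^ 2 := by
    rw [div_le_iff₀ (by linarith)]
    nlinarith [sq_nonneg x]
  have h4 := (abs_le.1 h).1
  rw [one_div, ← Real.exp_log (inv_pos.2 hpos), Real.log_inv]
  apply Real.exp_le_exp.2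
  linarith

theorem aux_S_moment {d : ℕ} (a : Fin d → ℝ) (ha0 : ∑ j, a j = 0) (ha1 : ∀ j, |a j| ≤ 1)
    (B t : ℝ) (hB : ∑ j, a j ^ 2 ≤ B) (ht : 0 < t) (ht2 : t ≤ 1 / 2) (m : ℕ) :
    ∫⁻ z : Fin d → ℂ, ENNReal.ofReal ((∑ j, a j * ‖z j‖ ^ 2) ^ (2 * m) * Real.exp (- nsq z)) ≤
      ENNReal.ofReal (2 * ((2 * m).factorial / t ^ (2 * m)) * (Real.exp (2 * t ^ 2 * B) * Real.pi ^ d)) := by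
  have hside : ∀ σ : ℝ, |σ| = 1 → ∫⁻ z : Fin d → ℂ, ENNReal.ofReal
      (Real.exp (∑ j, (σ * t * a j) * ‖z j‖ ^ 2) * Real.exp (- nsq z)) ≤
      ENNReal.ofReal (Real.exp (2 * t ^ 2 * B) * Real.pi ^ d) := by
    intro σ hσ
    have habs : ∀ j, |σ * t * a j| ≤ 1 / 2 := by
      intro j
      rw [abs_mul, abs_mul, hσ, one_mul, abs_of_pos ht]
      have := ha1 j
      nlinarith [abs_nonneg (a j)]
    rw [aux_exp_quad _ (fun j => by linarith [(abs_le.1 (habs j)).2])]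
    apply ENNReal.ofReal_le_ofReal
    calc ∏ j, Real.pi / (1 - σ * t * a j)
        ≤ ∏ j, (Real.exp (σ * t * a j + 2 * (σ * t * a j) ^ 2) * Real.pi) := by
          apply Finset.prod_le_prod
          · intro j _
            have := (abs_le.1 (habs j)).2
            exact div_nonneg Real.pi_pos.le (by linarith)
          · intro j _
            have := mul_le_mul_of_nonneg_right (aux_inv_le (habs j)) Real.pi_pos.le
            calc _ = 1 / (1 - σ * t * a j) * Real.pi := by ring
              _ ≤ _ := this
      _ = Real.exp (2 * t ^ 2 * ∑ j, a j ^ 2) * Real.pi ^ d := by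
          rw [Finset.prod_mul_distrib, ← Real.exp_sum, Finset.sum_add_distrib,
            ← Finset.mul_sum, ha0]
          have hs : σ ^ 2 = 1 := by rw [← sq_abs, hσ]; norm_num
          simp [mul_pow, hs, Finset.mul_sum, mul_assoc]
      _ ≤ _ := by gcongr
  have hpt : ∀ x : ℝ, x ^ (2 * m) ≤ ((2 * m).factorial / t ^ (2 * m)) *
      (Real.exp (t * x) + Real.exp (-(t * x))) := by
    intro x
    have h := Real.pow_div_factorial_le_exp |t * x| (abs_nonneg _) (2 * m)
    have h2 : |t * x| ^ (2 * m) = (t * x) ^ (2 * m) := by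
      rw [pow_mul, sq_abs, ← pow_mul]
    rw [h2, mul_pow, div_le_iff₀ (by positivity)] at h
    have h5 : Real.exp |t * x| ≤ Real.exp (t * x) + Real.exp (-(t * x)) := by
      rcases abs_cases (t * x) with ⟨h, _⟩ | ⟨h, _⟩ <;> rw [h] <;>
      linarith [Real.exp_pos (t * x), Real.exp_pos (-(t * x))]
    have hf : (0 : ℝ) < (2 * m).factorial := by exact_mod_cast Nat.factorial_pos _
    have h6 : x ^ (2 * m) = t ^ (2 * m) * x ^ (2 * m) / t ^ (2 * m) := by field_simp
    rw [h6]
    calc t ^ (2 * m) * x ^ (2 * m) / t ^ (2 * m) ≤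
        (Real.exp |t * x| * (2 * m).factorial) / t ^ (2 * m) := by gcongr
      _ ≤ ((Real.exp (t * x) + Real.exp (-(t * x))) * (2 * m).factorial) / t ^ (2 * m) := by
        gcongr
      _ = _ := by ring
  set C : ℝ := (2 * m).factorial / t ^ (2 * m) with hC
  have hC0 : 0 ≤ C := by positivity
  have h1 := hside 1 (by simp)
  have h2 := hside (-1) (by simp)
  calc _ ≤ ∫⁻ z : Fin d → ℂ, ENNReal.ofReal C * (ENNReal.ofReal
        (Real.exp (∑ j, (1 * t * a j) * ‖z j‖ ^ 2) * Real.exp (- nsq z)) + ENNReal.ofReal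
        (Real.exp (∑ j, (-1 * t * a j) * ‖z j‖ ^ 2) * Real.exp (- nsq z))) := by
        apply lintegral_mono
        intro z
        simp only
        rw [← ENNReal.ofReal_add (by positivity) (by positivity), ← ENNReal.ofReal_mul hC0]
        apply ENNReal.ofReal_le_ofReal
        have hp := mul_le_mul_of_nonneg_right (hpt (∑ j, a j * ‖z j‖ ^ 2))
          (Real.exp_pos (- nsq z)).le
        have e1 : ∑ j, (1 * t * a j) * ‖z j‖ ^ 2 = t * ∑ j, a j * ‖z j‖ ^ 2 := by
          rw [Finset.mul_sum]; exact Finset.sum_congr rfl fun _ _ => by ring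
        have e2 : ∑ j, (-1 * t * a j) * ‖z j‖ ^ 2 = -(t * ∑ j, a j * ‖z j‖ ^ 2) := by
          rw [Finset.mul_sum, ← Finset.sum_neg_distrib]
          exact Finset.sum_congr rfl fun _ _ => by ring
        rw [e1, e2, ← add_mul, ← mul_assoc]
        exact hp
    _ ≤ ENNReal.ofReal C * (ENNReal.ofReal (Real.exp (2 * t ^ 2 * B) * Real.pi ^ d)
         + ENNReal.ofReal (Real.exp (2 * t ^ 2 * B) * Real.pi ^ d)) := by
        rw [lintegral_const_mul' _ _ ENNReal.ofReal_ne_top, lintegral_add_left' (by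
          unfold nsq; fun_prop)]
        gcongr
    _ = _ := by
        rw [← ENNReal.ofReal_add (by positivity) (by positivity), ← ENNReal.ofReal_mul hC0]
        congr 1; ring


/-! ### Invariance -/

section invariance

variable {d : ℕ}

theorem meas_coe : Measurable (fun U : Matrix.unitaryGroup (Fin d) ℂ =>
    (U : Matrix (Fin d) (Fin d) ℂ)) := measurable_subtype_coe

theorem meas_entry (i j : Fin d) : Measurable (fun U : Matrix.unitaryGroup (Fin d) ℂ =>
    (U : Matrix (Fin d) (Fin d) ℂ) i j) :=
  (measurable_pi_apply j).comp ((measurable_pi_apply i).comp meas_coe)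

theorem meas_of_entry {α : Type*} [MeasurableSpace α] {f : α → Matrix.unitaryGroup (Fin d) ℂ}
    (h : ∀ i j, Measurable fun x => (f x : Matrix (Fin d) (Fin d) ℂ) i j) : Measurable f := by
  apply Measurable.subtype_mk (f := fun x => (f x : Matrix (Fin d) (Fin d) ℂ))
  exact measurable_pi_lambda _ fun i => measurable_pi_lambda _ fun j => h i j

theorem meas_mul : Measurable (fun p : Matrix.unitaryGroup (Fin d) ℂ ×
    Matrix.unitaryGroup (Fin d) ℂ => p.1 * p.2) := by
  apply meas_of_entry
  intro i j
  simp only [Matrix.UnitaryGroup.mul_val, Matrix.mul_apply]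
  exact Finset.measurable_sum _ fun k _ =>
    ((meas_entry i k).comp measurable_fst).mul ((meas_entry k j).comp measurable_snd)

theorem meas_inv : Measurable (fun p : Matrix.unitaryGroup (Fin d) ℂ => p⁻¹) := by
  apply meas_of_entry
  intro i j
  simp only [Matrix.UnitaryGroup.inv_val, Matrix.star_apply]
  exact (Complex.continuous_conj.measurable).comp (meas_entry j i)

theorem meas_mulVec (j : Fin d) : Measurable (fun p : Matrix.unitaryGroup (Fin d) ℂ ×
    (Fin d → ℂ) => ((p.1 : Matrix (Fin d) (Fin d) ℂ) *ᵥ p.2) j) := by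
  simp only [Matrix.mulVec, dotProduct]
  exact Finset.measurable_sum _ fun k _ =>
    ((meas_entry j k).comp measurable_fst).mul ((measurable_pi_apply k).comp measurable_snd)

theorem meas_mulVec' : Measurable (fun p : Matrix.unitaryGroup (Fin d) ℂ ×
    (Fin d → ℂ) => ((p.1 : Matrix (Fin d) (Fin d) ℂ) *ᵥ p.2)) :=
  measurable_pi_lambda _ meas_mulVec

theorem left_inv_lint (μ : Measure (Matrix.unitaryGroup (Fin d) ℂ))
    (hinv : ∀ V : Matrix.unitaryGroup (Fin d) ℂ, μ.map (fun U => V * U) = μ)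
    (f : Matrix.unitaryGroup (Fin d) ℂ → ENNReal) (hf : Measurable f)
    (W : Matrix.unitaryGroup (Fin d) ℂ) : ∫⁻ U, f (W * U) ∂μ = ∫⁻ U, f U ∂μ := by
  conv_rhs => rw [← hinv W]
  rw [lintegral_map hf]
  exact meas_mul.comp (measurable_const.prodMk measurable_id)

theorem inv_inv_lint (μ : Measure (Matrix.unitaryGroup (Fin d) ℂ)) [IsProbabilityMeasure μ]
    (hinv : ∀ V : Matrix.unitaryGroup (Fin d) ℂ, μ.map (fun U => V * U) = μ)
    (f : Matrix.unitaryGroup (Fin d) ℂ → ENNReal) (hf : Measurable f) :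
    ∫⁻ U, f U ∂μ = ∫⁻ U, f U⁻¹ ∂μ := by
  calc ∫⁻ U, f U ∂μ = ∫⁻ W, ∫⁻ U, f (W⁻¹ * U) ∂μ ∂μ := by
        simp only [left_inv_lint μ hinv f hf]
        simp
    _ = ∫⁻ U, ∫⁻ W, f (W⁻¹ * U) ∂μ ∂μ := by
        apply lintegral_lintegral_swap
        exact (hf.comp (meas_mul.comp
          ((meas_inv.comp measurable_fst).prodMk measurable_snd))).aemeasurable
    _ = ∫⁻ U, ∫⁻ W, f (W⁻¹) ∂μ ∂μ := by
        congr 1; ext U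
        have := left_inv_lint μ hinv (fun W => f W⁻¹) (hf.comp meas_inv) U⁻¹
        rw [← this]
        simp
    _ = _ := by simp

theorem right_inv_lint (μ : Measure (Matrix.unitaryGroup (Fin d) ℂ)) [IsProbabilityMeasure μ]
    (hinv : ∀ V : Matrix.unitaryGroup (Fin d) ℂ, μ.map (fun U => V * U) = μ)
    (f : Matrix.unitaryGroup (Fin d) ℂ → ENNReal) (hf : Measurable f)
    (W : Matrix.unitaryGroup (Fin d) ℂ) : ∫⁻ U, f (U * W) ∂μ = ∫⁻ U, f U ∂μ := by
  rw [inv_inv_lint μ hinv f hf, inv_inv_lint μ hinv (fun U => f (U * W))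
    (hf.comp (meas_mul.comp (measurable_id.prodMk measurable_const)))]
  rw [← left_inv_lint μ hinv (fun U => f U⁻¹) (hf.comp meas_inv) W⁻¹]
  simp

theorem nsq_eq_dot (z : Fin d → ℂ) : (nsq z : ℂ) = star z ⬝ᵥ z := by
  simp only [nsq, dotProduct, Complex.ofReal_sum, Pi.star_apply]
  refine Finset.sum_congr rfl fun j _ => ?_
  rw [Complex.star_def, mul_comm, Complex.mul_conj, Complex.normSq_eq_norm_sq]

theorem nsq_unitary (W : Matrix.unitaryGroup (Fin d) ℂ) (z : Fin d → ℂ) :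
    nsq ((W : Matrix (Fin d) (Fin d) ℂ) *ᵥ z) = nsq z := by
  have : (nsq ((W : Matrix (Fin d) (Fin d) ℂ) *ᵥ z) : ℂ) = nsq z := by
    rw [nsq_eq_dot, nsq_eq_dot, Matrix.star_mulVec, ← Matrix.dotProduct_mulVec,
      Matrix.mulVec_mulVec]
    have h := W.2
    rw [Matrix.mem_unitaryGroup_iff', Matrix.star_eq_conjTranspose] at h
    rw [h, Matrix.one_mulVec]
  exact_mod_cast this

theorem nsq_smul (r : ℝ) (z : Fin d → ℂ) : nsq ((r : ℂ) • z) = r ^ 2 * nsq z := by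
  simp [nsq, mul_pow, Finset.mul_sum]

theorem exists_unitary (i0 : Fin d) (w : Fin d → ℂ) (hw : nsq w = 1) :
    ∃ B : Matrix.unitaryGroup (Fin d) ℂ,
      (B : Matrix (Fin d) (Fin d) ℂ) *ᵥ (Pi.single i0 1) = w := by
  have hn : ‖(WithLp.toLp 2 w : EuclideanSpace ℂ (Fin d))‖ = 1 := by
    rw [EuclideanSpace.norm_eq]
    simp only [nsq] at hw
    simp [hw]
  obtain ⟨b, hb⟩ := Orthonormal.exists_orthonormalBasis_extension_of_card_eq (𝕜 := ℂ)
    (E := EuclideanSpace ℂ (Fin d)) (ι := Fin d) (by simp)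
    (v := fun _ => WithLp.toLp 2 w) (s := {i0}) (by
      constructor
      · intro _; simpa using hn
      · intro i j hij
        exact absurd (Subsingleton.elim i j) hij)
  refine ⟨⟨_, (EuclideanSpace.basisFun (Fin d) ℂ).toMatrix_orthonormalBasis_mem_unitary b⟩, ?_⟩
  ext j
  have := hb i0 (by simp)
  simp [Module.Basis.toMatrix_apply, this]

theorem vol_unitary (W : Matrix.unitaryGroup (Fin d) ℂ) :
    (volume : Measure (Fin d → ℂ)).map (fun z => (W : Matrix (Fin d) (Fin d) ℂ) *ᵥ z)
      = volume := by
  let L : (Fin d → ℂ) →ₗ[ℝ] (Fin d → ℂ) :=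
    (Matrix.mulVecLin (W : Matrix (Fin d) (Fin d) ℂ)).restrictScalars ℝ
  have hL : ∀ z, L z = (W : Matrix (Fin d) (Fin d) ℂ) *ᵥ z := fun z => rfl
  have hdet : LinearMap.det L ≠ 0 := by
    have h2 : (W : Matrix (Fin d) (Fin d) ℂ) * (W⁻¹ : Matrix.unitaryGroup (Fin d) ℂ) = 1 := by
      rw [← Matrix.UnitaryGroup.mul_val]; simp
    let L' : (Fin d → ℂ) →ₗ[ℝ] (Fin d → ℂ) :=
      (Matrix.mulVecLin ((W⁻¹ : Matrix.unitaryGroup (Fin d) ℂ) :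
        Matrix (Fin d) (Fin d) ℂ)).restrictScalars ℝ
    have : L * L' = 1 := by
      refine LinearMap.ext fun z => ?_
      show (W : Matrix (Fin d) (Fin d) ℂ) *ᵥ
        (((W⁻¹ : Matrix.unitaryGroup (Fin d) ℂ) : Matrix (Fin d) (Fin d) ℂ) *ᵥ z) = z
      rw [Matrix.mulVec_mulVec, h2, Matrix.one_mulVec]
    have h3 := congrArg LinearMap.det this
    rw [map_mul, map_one] at h3
    exact left_ne_zero_of_mul_eq_one h3
  have h := Measure.map_linearMap_addHaar_eq_smul_addHaar (volume : Measure (Fin d → ℂ)) hdet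
  change Measure.map (fun z => (W : Matrix (Fin d) (Fin d) ℂ) *ᵥ z) volume = _ at h
  have hmeas : Measurable (fun z : Fin d → ℂ => (W : Matrix (Fin d) (Fin d) ℂ) *ᵥ z) :=
    meas_mulVec'.comp (measurable_const.prodMk measurable_id)
  have hg : Measurable fun z : Fin d → ℂ => ENNReal.ofReal (Real.exp (- nsq z)) := by
    unfold nsq; fun_prop
  have h1 : ∫⁻ z, ENNReal.ofReal (Real.exp (- nsq z))
      ∂(Measure.map (fun z => (W : Matrix (Fin d) (Fin d) ℂ) *ᵥ z) volume) =
      ∫⁻ z : Fin d → ℂ, ENNReal.ofReal (Real.exp (- nsq z)) := by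
    rw [lintegral_map hg hmeas]
    simp only [nsq_unitary]
  have hc := h1
  rw [h, lintegral_smul_measure, aux_mass, smul_eq_mul] at hc
  have hne : ENNReal.ofReal (Real.pi ^ d) ≠ 0 := by
    simp [Real.pi_pos]
  have hc1 : ENNReal.ofReal |(LinearMap.det L)⁻¹| = 1 := by
    exact (ENNReal.mul_eq_right hne ENNReal.ofReal_ne_top).1 hc
  rw [h, hc1, one_smul]

theorem haar_gauss (μ : Measure (Matrix.unitaryGroup (Fin d) ℂ)) [IsProbabilityMeasure μ]
    (hinv : ∀ V : Matrix.unitaryGroup (Fin d) ℂ, μ.map (fun U => V * U) = μ)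
    (i0 : Fin d) (v : Fin d → ℂ) (hv : nsq v = 1) (a : Fin d → ℝ) (k : ℕ) (hk : 0 < k)
    (hke : Even k) :
    (∫⁻ U, ENNReal.ofReal ((∑ j, a j * ‖((U : Matrix (Fin d) (Fin d) ℂ) *ᵥ v) j‖ ^ 2) ^ k) ∂μ) *
      (∫⁻ z : Fin d → ℂ, ENNReal.ofReal (nsq z ^ k * Real.exp (- nsq z))) =
      ∫⁻ z : Fin d → ℂ, ENNReal.ofReal ((∑ j, a j * ‖z j‖ ^ 2) ^ k * Real.exp (- nsq z)) := by
  set F : (Fin d → ℂ) → ENNReal := fun z => ENNReal.ofReal ((∑ j, a j * ‖z j‖ ^ 2) ^ k) with hF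
  have hFm : Measurable F := by rw [hF]; fun_prop
  have hg : Measurable fun z : Fin d → ℂ => ENNReal.ofReal (Real.exp (- nsq z)) := by
    unfold nsq; fun_prop
  have hFU : ∀ w : Fin d → ℂ, Measurable fun U : Matrix.unitaryGroup (Fin d) ℂ =>
      F ((U : Matrix (Fin d) (Fin d) ℂ) *ᵥ w) := fun w =>
    hFm.comp (meas_mulVec'.comp (measurable_id.prodMk measurable_const))
  -- the average does not depend on the unit vector
  have hconst : ∀ w : Fin d → ℂ, nsq w = 1 →
      ∫⁻ U, F ((U : Matrix (Fin d) (Fin d) ℂ) *ᵥ w) ∂μ =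
      ∫⁻ U, F ((U : Matrix (Fin d) (Fin d) ℂ) *ᵥ (Pi.single i0 1)) ∂μ := by
    intro w hw
    obtain ⟨B, hB⟩ := exists_unitary i0 w hw
    rw [← right_inv_lint μ hinv _ (hFU (Pi.single i0 1)) B]
    congr 1; ext U
    rw [Matrix.UnitaryGroup.mul_val, ← Matrix.mulVec_mulVec, hB]
  have hhom : ∀ z : Fin d → ℂ, ∫⁻ U, F ((U : Matrix (Fin d) (Fin d) ℂ) *ᵥ z) ∂μ =
      ENNReal.ofReal (nsq z ^ k) * ∫⁻ U, F ((U : Matrix (Fin d) (Fin d) ℂ) *ᵥ v) ∂μ := by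
    intro z
    rcases (nsq_nonneg z).eq_or_lt with h0 | h0
    · have hz : z = 0 := by
        ext j
        have := (Finset.sum_eq_zero_iff_of_nonneg
          (fun j _ => by positivity : ∀ j ∈ Finset.univ, 0 ≤ ‖z j‖ ^ 2)).1 h0.symm j
          (Finset.mem_univ j)
        simpa using this
      rw [← h0, hz]
      simp [hF, hk.ne']
    · set r := Real.sqrt (nsq z) with hr
      have hr0 : 0 < r := Real.sqrt_pos.2 h0
      have hr2 : r ^ 2 = nsq z := Real.sq_sqrt h0.le
      have hw : nsq (((r⁻¹ : ℝ) : ℂ) • z) = 1 := by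
        rw [nsq_smul, ← hr2]; field_simp
      rw [hconst v hv, ← hconst _ hw, ← lintegral_const_mul _ (hFU _)]
      congr 1; ext U
      rw [Matrix.mulVec_smul]
      simp only [hF]
      rw [← ENNReal.ofReal_mul (by positivity), ← mul_pow]
      congr 2
      simp only [Pi.smul_apply, smul_eq_mul, norm_mul, Complex.norm_real, Real.norm_eq_abs,
        mul_pow, sq_abs]
      rw [← hr2, Finset.mul_sum]
      refine Finset.sum_congr rfl fun j _ => ?_
      field_simp
  have hsplit : ∀ z : Fin d → ℂ, ENNReal.ofReal ((∑ j, a j * ‖z j‖ ^ 2) ^ k * Real.exp (- nsq z))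
      = F z * ENNReal.ofReal (Real.exp (- nsq z)) := fun z => ENNReal.ofReal_mul (hke.pow_nonneg _)
  have hsplit2 : ∀ z : Fin d → ℂ, ENNReal.ofReal (nsq z ^ k * Real.exp (- nsq z))
      = ENNReal.ofReal (nsq z ^ k) * ENNReal.ofReal (Real.exp (- nsq z)) :=
    fun z => ENNReal.ofReal_mul (hke.pow_nonneg _)
  have hfin : Measurable fun z : Fin d → ℂ =>
      ENNReal.ofReal (nsq z ^ k) * ENNReal.ofReal (Real.exp (- nsq z)) := by
    unfold nsq; fun_prop
  simp only [hsplit, hsplit2]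
  symm
  calc ∫⁻ z : Fin d → ℂ, F z * ENNReal.ofReal (Real.exp (- nsq z))
      = ∫⁻ U : Matrix.unitaryGroup (Fin d) ℂ, (∫⁻ z : Fin d → ℂ,
          F ((U : Matrix (Fin d) (Fin d) ℂ) *ᵥ z) * ENNReal.ofReal (Real.exp (- nsq z))) ∂μ := by
        have : ∀ U : Matrix.unitaryGroup (Fin d) ℂ, (∫⁻ z : Fin d → ℂ,
          F ((U : Matrix (Fin d) (Fin d) ℂ) *ᵥ z) * ENNReal.ofReal (Real.exp (- nsq z))) =
          ∫⁻ z : Fin d → ℂ, F z * ENNReal.ofReal (Real.exp (- nsq z)) := by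
          intro U
          conv_rhs => rw [← vol_unitary U]
          have hmeas : Measurable (fun z : Fin d → ℂ => (U : Matrix (Fin d) (Fin d) ℂ) *ᵥ z) :=
            meas_mulVec'.comp (measurable_const.prodMk measurable_id)
          have hFg : Measurable fun z : Fin d → ℂ =>
            F z * ENNReal.ofReal (Real.exp (- nsq z)) := hFm.mul hg
          rw [lintegral_map hFg hmeas]
          simp only [nsq_unitary]
        simp [this]
    _ = ∫⁻ z : Fin d → ℂ, (∫⁻ U : Matrix.unitaryGroup (Fin d) ℂ,
          F ((U : Matrix (Fin d) (Fin d) ℂ) *ᵥ z) * ENNReal.ofReal (Real.exp (- nsq z)) ∂μ) := by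
        apply lintegral_lintegral_swap
        exact ((hFm.comp meas_mulVec').mul (hg.comp measurable_snd)).aemeasurable
    _ = ∫⁻ z : Fin d → ℂ, (∫⁻ U, F ((U : Matrix (Fin d) (Fin d) ℂ) *ᵥ v) ∂μ) *
          (ENNReal.ofReal (nsq z ^ k) * ENNReal.ofReal (Real.exp (- nsq z))) := by
        congr 1; ext z
        rw [lintegral_mul_const _ (hFU z), hhom z]
        ring
    _ = _ := by rw [lintegral_const_mul _ hfin]

theorem integ_quad (μ : Measure (Matrix.unitaryGroup (Fin d) ℂ)) [IsProbabilityMeasure μ]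
    (v : Fin d → ℂ) (hv : nsq v = 1) (a : Fin d → ℝ) (k : ℕ) :
    Integrable (fun U : Matrix.unitaryGroup (Fin d) ℂ =>
      (∑ j, a j * ‖((U : Matrix (Fin d) (Fin d) ℂ) *ᵥ v) j‖ ^ 2) ^ k) μ := by
  have hm : Measurable (fun U : Matrix.unitaryGroup (Fin d) ℂ =>
      (∑ j, a j * ‖((U : Matrix (Fin d) (Fin d) ℂ) *ᵥ v) j‖ ^ 2) ^ k) := by
    have : ∀ j, Measurable (fun U : Matrix.unitaryGroup (Fin d) ℂ =>
       ((U : Matrix (Fin d) (Fin d) ℂ) *ᵥ v) j) := fun j =>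
      (meas_mulVec j).comp (measurable_id.prodMk measurable_const)
    fun_prop
  apply Integrable.of_bound hm.aestronglyMeasurable ((∑ j, |a j|) ^ k)
  refine Filter.Eventually.of_forall fun U => ?_
  rw [norm_pow]
  gcongr
  refine (Finset.abs_sum_le_sum_abs _ _).trans (Finset.sum_le_sum fun j _ => ?_)
  rw [abs_mul]
  have h1 : ‖((U : Matrix (Fin d) (Fin d) ℂ) *ᵥ v) j‖ ^ 2 ≤ 1 := by
    rw [← hv, ← nsq_unitary U v]
    exact Finset.single_le_sum (f := fun j => ‖((U : Matrix (Fin d) (Fin d) ℂ) *ᵥ v) j‖ ^ 2)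
      (fun _ _ => by positivity) (Finset.mem_univ j)
  rw [abs_of_nonneg (by positivity : 0 ≤ ‖((U : Matrix (Fin d) (Fin d) ℂ) *ᵥ v) j‖ ^ 2)]
  exact mul_le_of_le_one_right (abs_nonneg _) h1

/-- centered moments under Haar -/
theorem haar_moment (μ : Measure (Matrix.unitaryGroup (Fin d) ℂ)) [IsProbabilityMeasure μ]
    (hinv : ∀ V : Matrix.unitaryGroup (Fin d) ℂ, μ.map (fun U => V * U) = μ)
    (hd : 0 < d) (v : Fin d → ℂ) (hv : nsq v = 1) (a : Fin d → ℝ)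
    (ha0 : ∑ j, a j = 0) (ha1 : ∀ j, |a j| ≤ 1) (m : ℕ) (hm : 0 < m)
    (B t : ℝ) (hB : ∑ j, a j ^ 2 ≤ B) (ht : 0 < t) (ht2 : t ≤ 1 / 2) :
    ∫ U, (∑ j, a j * ‖((U : Matrix (Fin d) (Fin d) ℂ) *ᵥ v) j‖ ^ 2) ^ (2 * m) ∂μ ≤
      2 * ((2 * m).factorial / t ^ (2 * m)) * Real.exp (2 * t ^ 2 * B) / (d : ℝ) ^ (2 * m) := by
  have hd' : (0 : ℝ) < d := by exact_mod_cast hd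
  have h1 := haar_gauss μ hinv ⟨0, hd⟩ v hv a (2 * m) (by omega) (even_two_mul m)
  have h2 := aux_S_moment a ha0 ha1 B t hB ht ht2 m
  have h3 := aux_norm_moment d (2 * m) hd (by omega)
  rw [← ofReal_integral_eq_lintegral_ofReal (integ_quad μ v hv a _)
    (Filter.Eventually.of_forall fun U => (even_two_mul m).pow_nonneg _)] at h1
  set I := ∫ U, (∑ j, a j * ‖((U : Matrix (Fin d) (Fin d) ℂ) *ᵥ v) j‖ ^ 2) ^ (2 * m) ∂μ
  have hI : 0 ≤ I := integral_nonneg fun U => (even_two_mul m).pow_nonneg _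
  have h4 : ENNReal.ofReal I * ENNReal.ofReal ((d : ℝ) ^ (2 * m) * Real.pi ^ d) ≤
      ENNReal.ofReal (2 * ((2 * m).factorial / t ^ (2 * m)) *
        (Real.exp (2 * t ^ 2 * B) * Real.pi ^ d)) :=
    (mul_le_mul_right h3 _).trans (h1.le.trans h2)
  rw [← ENNReal.ofReal_mul hI, ENNReal.ofReal_le_ofReal_iff (by positivity)] at h4
  rw [le_div_iff₀ (by positivity)]
  have hp : 0 < Real.pi ^ d := by positivity
  apply le_of_mul_le_mul_right _ hp
  linarith

end invariance

/-! ### Transfer to the expander -/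

section transfer

variable {d : ℕ}

theorem tpow_mul (M N : Matrix (Fin d) (Fin d) ℂ) (t : ℕ) :
    tpow M t * tpow N t = tpow (M * N) t := by
  ext a b
  simp only [tpow, Matrix.mul_apply, Matrix.of_apply, ← Finset.prod_mul_distrib]
  rw [Finset.prod_univ_sum]
  simp

theorem conjAct_diag (U : Matrix (Fin d) (Fin d) ℂ) (v : Fin d → ℂ) (t : ℕ)
    (a : Fin t → Fin d) :
    conjAct t U (tpow (Matrix.vecMulVec v (star v)) t) a a =
      ((∏ k, ‖(U *ᵥ v) (a k)‖ ^ 2 : ℝ) : ℂ) := by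
  rw [conjAct, tpow_mul, tpow_mul, Matrix.mul_vecMulVec, Matrix.vecMulVec_mul,
    ← Matrix.star_mulVec]
  simp only [tpow, Matrix.of_apply, Matrix.vecMulVec_apply, Pi.star_apply, Complex.ofReal_prod]
  refine Finset.prod_congr rfl fun k _ => ?_
  rw [Complex.star_def, Complex.mul_conj, Complex.normSq_eq_norm_sq]

theorem frob_pure (v : Fin d → ℂ) (hv : nsq v = 1) (t : ℕ) :
    frobNorm (tpow (Matrix.vecMulVec v (star v)) t) = 1 := by
  have : ∑ a : Fin t → Fin d, ∑ b : Fin t → Fin d,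
      ‖tpow (Matrix.vecMulVec v (star v)) t a b‖ ^ 2 = 1 := by
    have h1 : ∀ a b : Fin t → Fin d, ‖tpow (Matrix.vecMulVec v (star v)) t a b‖ ^ 2 =
        (∏ k, ‖v (a k)‖ ^ 2) * ∏ k, ‖v (b k)‖ ^ 2 := by
      intro a b
      simp only [tpow, Matrix.of_apply, Matrix.vecMulVec_apply, Pi.star_apply, norm_prod,
        norm_mul, norm_star, Finset.prod_mul_distrib, mul_pow, Finset.prod_pow]
    simp only [h1]
    rw [← Finset.sum_mul_sum, ← Fintype.sum_pow (fun j => ‖v j‖ ^ 2)]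
    simp only [nsq] at hv
    rw [hv]; simp
  rw [frobNorm, this, Real.sqrt_one]

theorem quad_pow (w : Fin d → ℂ) (α : Fin d → ℝ) (t : ℕ) :
    (∑ j, α j * ‖w j‖ ^ 2) ^ t =
      ∑ a : Fin t → Fin d, (∏ k, α (a k)) * ∏ k, ‖w (a k)‖ ^ 2 := by
  rw [Fintype.sum_pow]
  exact Finset.sum_congr rfl fun a _ => Finset.prod_mul_distrib

theorem tpe_moment (μ : Measure (Matrix.unitaryGroup (Fin d) ℂ)) [IsProbabilityMeasure μ]
    (s : ℕ) (V : Fin s → Matrix.unitaryGroup (Fin d) ℂ) (lam : ℝ) (m : ℕ)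
    (hV : IsTPE μ (2 * m) lam V) (v : Fin d → ℂ) (hv : nsq v = 1) (α : Fin d → ℝ) :
    (∑ k, (∑ j, α j * ‖((V k : Matrix (Fin d) (Fin d) ℂ) *ᵥ v) j‖ ^ 2) ^ (2 * m)) / s ≤
      ∫ U, (∑ j, α j * ‖((U : Matrix (Fin d) (Fin d) ℂ) *ᵥ v) j‖ ^ 2) ^ (2 * m) ∂μ +
        lam * (∑ j, α j ^ 2) ^ m := by
  set t := 2 * m with ht
  set M := tpow (Matrix.vecMulVec v (star v)) t with hM
  have h := hV M
  rw [hM, frob_pure v hv, mul_one, ← hM] at h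
  set Δ := ((Fintype.card (Fin s) : ℂ)⁻¹ •
        (∑ i, conjAct t ((V i : Matrix (Fin d) (Fin d) ℂ)) M) - haarAvg μ t M) with hΔ
  -- diagonal entries
  let δ : (Fin t → Fin d) → ℝ := fun a =>
    (∑ i, ∏ k, ‖((V i : Matrix (Fin d) (Fin d) ℂ) *ᵥ v) (a k)‖ ^ 2) / s -
      ∫ U, ∏ k, ‖((U : Matrix (Fin d) (Fin d) ℂ) *ᵥ v) (a k)‖ ^ 2 ∂μ
  have hδ : ∀ a, Δ a a = (δ a : ℂ) := by
    intro a
    simp only [hΔ, δ, Matrix.sub_apply, Matrix.smul_apply, Matrix.sum_apply, haarAvg,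
      Matrix.of_apply, hM, conjAct_diag, Fintype.card_fin, smul_eq_mul]
    rw [integral_complex_ofReal]
    push_cast
    ring
  have hprodint : ∀ a : Fin t → Fin d, Integrable (fun U : Matrix.unitaryGroup (Fin d) ℂ =>
      ∏ k, ‖((U : Matrix (Fin d) (Fin d) ℂ) *ᵥ v) (a k)‖ ^ 2) μ := by
    intro a
    have hm : ∀ j, Measurable (fun U : Matrix.unitaryGroup (Fin d) ℂ =>
       ((U : Matrix (Fin d) (Fin d) ℂ) *ᵥ v) j) := fun j =>
      (meas_mulVec j).comp (measurable_id.prodMk measurable_const)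
    have hm' : Measurable (fun U : Matrix.unitaryGroup (Fin d) ℂ =>
      ∏ k, ‖((U : Matrix (Fin d) (Fin d) ℂ) *ᵥ v) (a k)‖ ^ 2) := by
      fun_prop
    apply Integrable.of_bound hm'.aestronglyMeasurable 1
    refine Filter.Eventually.of_forall fun U => ?_
    rw [Real.norm_of_nonneg (Finset.prod_nonneg fun _ _ => by positivity)]
    apply Finset.prod_le_one (fun _ _ => by positivity)
    intro k _
    rw [← hv, ← nsq_unitary U v]
    exact Finset.single_le_sum (f := fun j => ‖((U : Matrix (Fin d) (Fin d) ℂ) *ᵥ v) j‖ ^ 2)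
      (fun _ _ => by positivity) (Finset.mem_univ _)
  have hdiff : (∑ k, (∑ j, α j * ‖((V k : Matrix (Fin d) (Fin d) ℂ) *ᵥ v) j‖ ^ 2) ^ t) / s -
      ∫ U, (∑ j, α j * ‖((U : Matrix (Fin d) (Fin d) ℂ) *ᵥ v) j‖ ^ 2) ^ t ∂μ =
      ∑ a : Fin t → Fin d, (∏ k, α (a k)) * δ a := by
    simp only [quad_pow, δ, mul_sub, Finset.sum_sub_distrib]
    congr 1
    · rw [Finset.sum_comm, Finset.sum_div]
      refine Finset.sum_congr rfl fun a _ => ?_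
      rw [← Finset.mul_sum]; ring
    · rw [integral_finsetSum _ fun a _ => (hprodint a).const_mul _]
      refine Finset.sum_congr rfl fun a _ => ?_
      rw [integral_const_mul]
  have hδsum : Real.sqrt (∑ a, δ a ^ 2) ≤ frobNorm Δ := by
    apply Real.sqrt_le_sqrt
    refine Finset.sum_le_sum fun a _ => ?_
    have : δ a ^ 2 = ‖Δ a a‖ ^ 2 := by
      rw [hδ, Complex.norm_real, Real.norm_eq_abs, sq_abs]
    rw [this]
    exact Finset.single_le_sum (f := fun b => ‖Δ a b‖ ^ 2) (fun _ _ => by positivity)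
      (Finset.mem_univ a)
  have hα : Real.sqrt (∑ a : Fin t → Fin d, (∏ k, α (a k)) ^ 2) = (∑ j, α j ^ 2) ^ m := by
    have h0 : 0 ≤ ∑ j, α j ^ 2 := Finset.sum_nonneg fun _ _ => sq_nonneg _
    simp only [← Finset.prod_pow]
    rw [← Fintype.sum_pow (fun j => α j ^ 2), ht, mul_comm 2 m, pow_mul,
      Real.sqrt_sq (by positivity)]
  have hcs := Real.sum_mul_le_sqrt_mul_sqrt Finset.univ
    (fun a : Fin t → Fin d => ∏ k, α (a k)) δ
  rw [hα] at hcs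
  have h0 : 0 ≤ (∑ j, α j ^ 2) ^ m := by positivity
  have := mul_le_mul_of_nonneg_left (hδsum.trans h) h0
  linarith

end transfer

/-! ### Final assembly -/

theorem block_sum (d1 d2 i : ℕ) (hd2 : 0 < d2) (hdvd : d2 ∣ d1) (hi : i < d1 / d2) :
    ∑ j : Fin d1, (if j.val / d2 = i then (1 : ℝ) else 0) = d2 := by
  rw [Fin.sum_univ_eq_sum_range (fun j => if j / d2 = i then (1 : ℝ) else 0) d1, Finset.sum_boole]
  have : (Finset.range d1).filter (fun j => j / d2 = i) = Finset.Ico (i * d2) ((i + 1) * d2) := by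
    ext j
    simp only [Finset.mem_filter, Finset.mem_range, Finset.mem_Ico]
    rw [Nat.div_eq_iff hd2]
    have h1 : (i + 1) * d2 ≤ d1 := by
      calc (i + 1) * d2 ≤ (d1 / d2) * d2 := Nat.mul_le_mul_right _ hi
        _ ≤ d1 := Nat.div_mul_le_self _ _
    have h2 : (i + 1) * d2 = i * d2 + d2 := by ring
    omega
  rw [this, Nat.card_Ico]
  congr 1
  have h2 : (i + 1) * d2 = i * d2 + d2 := by ring
  omega

theorem markov_count {s : ℕ} (P : Fin s → Prop) [DecidablePred P] (g : Fin s → ℝ) (c : ℝ) (m : ℕ)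
    (hc : 0 ≤ c) (h : ∀ k, P k → c ≤ |g k|) :
    ((Finset.univ.filter P).card : ℝ) / s * (c ^ 2) ^ m ≤ (∑ k, g k ^ (2 * m)) / s := by
  rw [div_mul_eq_mul_div]
  gcongr
  calc ((Finset.univ.filter P).card : ℝ) * (c ^ 2) ^ m
      = ∑ k ∈ Finset.univ.filter P, (c ^ 2) ^ m := by simp
    _ ≤ ∑ k ∈ Finset.univ.filter P, g k ^ (2 * m) := by
        refine Finset.sum_le_sum fun k hk => ?_
        rw [pow_mul (g k), ← sq_abs (g k)]
        have := h k (Finset.mem_filter.1 hk).2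
        gcongr
    _ ≤ _ := Finset.sum_le_sum_of_subset_of_nonneg (Finset.filter_subset _ _)
        fun k _ _ => (even_two_mul m).pow_nonneg _

theorem cvx (x y : ℝ) (m : ℕ) :
    (x + y) ^ (2 * m) ≤ (36 / 25 * x ^ 2) ^ m + (36 * y ^ 2) ^ m := by
  have h := (even_two_mul m).convexOn_pow (𝕜 := ℝ) |>.2 (Set.mem_univ (6 / 5 * x))
    (Set.mem_univ (6 * y)) (by norm_num : (0 : ℝ) ≤ 5 / 6) (by norm_num : (0 : ℝ) ≤ 1 / 6)
    (by norm_num)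
  simp only [smul_eq_mul] at h
  have e1 : 5 / 6 * (6 / 5 * x) + 1 / 6 * (6 * y) = x + y := by ring
  have e2 : (6 / 5 * x) ^ (2 * m) = (36 / 25 * x ^ 2) ^ m := by rw [pow_mul]; congr 1; ring
  have e3 : (6 * y) ^ (2 * m) = (36 * y ^ 2) ^ m := by rw [pow_mul]; congr 1; ring
  rw [e1, e2, e3] at h
  have p1 : 0 ≤ (36 / 25 * x ^ 2) ^ m := by positivity
  have p2 : 0 ≤ (36 * y ^ 2) ^ m := by positivity
  linarith

theorem pow_exp_le (x y : ℝ) (m : ℕ) (hx : 0 ≤ x) (h : x * Real.exp 1 ≤ y) :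
    x ^ m ≤ y ^ m * Real.exp (-(m : ℝ)) := by
  have : Real.exp (-(m : ℝ)) = (Real.exp (-1)) ^ m := by
    rw [← Real.exp_nat_mul]; congr 1; ring
  rw [this, ← mul_pow]
  gcongr
  rw [Real.exp_neg, ← div_eq_mul_inv, le_div_iff₀ (Real.exp_pos _)]
  exact h

theorem exp_three : Real.exp 2 * Real.exp 1 ≤ 21 := by
  have h := Real.exp_one_lt_d9
  have h2 : Real.exp 2 = Real.exp 1 ^ 2 := by rw [← Real.exp_nat_mul]; norm_num
  rw [h2, ← pow_succ]
  calc Real.exp 1 ^ 3 ≤ (2.72 : ℝ) ^ 3 := by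
        gcongr; linarith
    _ ≤ 21 := by norm_num

theorem arith_up {N c S K L E P : ℝ} (h1 : N * c ≤ S) (h2 : S ≤ K + L) (h3 : L ≤ c * E)
    (hK : K ≤ 2 * P) (h4 : P ≤ c * E) : N * c ≤ 3 * E * c := by linarith

set_option maxHeartbeats 2000000 in
/-- **Proposition 3.1 (quantum JL via a TPE, single vector):** if `U` is chosen uniformly at
random from the unitaries `V₁, ..., Vₛ` of a `(d₁, s, λ, 2m)`-TPE with `m = 2⁻¹⁰ ε² d₂` and
`λ ≤ (4ε²d₂/d₁²)^m e^{-m}`, then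
`Pr_U[‖Π_i U v‖₂ ∉ [(1-ε)√(d₂/d₁), (1+ε)√(d₂/d₁)]] ≤ 2⁶ exp(−2⁻¹⁰ ε² d₂)`. -/
theorem tpe_projection_concentration
    (d1 d2 : ℕ) (hd : d2 < d1) (hdvd : d2 ∣ d1)
    (v : Fin d1 → ℂ) (hv : l2norm v = 1)
    (i : ℕ) (hi : i < d1 / d2)
    (ε : ℝ) (hε : 0 < ε) (hε1 : ε < 1)
    (m : ℕ) (hm : 0 < m) (hmval : (m : ℝ) = ε ^ 2 * d2 / 2 ^ 10)
    (μ : Measure (Matrix.unitaryGroup (Fin d1) ℂ)) [IsProbabilityMeasure μ]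
    (hinv : ∀ V : Matrix.unitaryGroup (Fin d1) ℂ, μ.map (fun U => V * U) = μ)
    (s : ℕ) (hs : 0 < s) (lam : ℝ) (V : Fin s → Matrix.unitaryGroup (Fin d1) ℂ)
    (hlam : lam ≤ (4 * ε ^ 2 * d2 / (d1 : ℝ) ^ 2) ^ m * Real.exp (-(m : ℝ)))
    (hV : IsTPE μ (2 * m) lam V) :
    ((Finset.univ.filter fun k : Fin s =>
        ¬((1 - ε) * Real.sqrt ((d2 : ℝ) / d1)
            ≤ l2norm ((blockProj d1 d2 i).mulVec ((V k : Matrix (Fin d1) (Fin d1) ℂ).mulVec v)) ∧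
          l2norm ((blockProj d1 d2 i).mulVec ((V k : Matrix (Fin d1) (Fin d1) ℂ).mulVec v))
            ≤ (1 + ε) * Real.sqrt ((d2 : ℝ) / d1))).card : ℝ) / s
      ≤ 2 ^ 6 * Real.exp (-(ε ^ 2 * d2) / 2 ^ 10) := by
  have hd2 : 0 < d2 := by
    rcases Nat.eq_zero_or_pos d2 with h | h
    · subst h; simp at hi
    · exact h
  have hd1 : 0 < d1 := by omega
  have hd2' : (0 : ℝ) < d2 := by exact_mod_cast hd2
  have hd1' : (0 : ℝ) < d1 := by exact_mod_cast hd1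
  have hdlt : (d2 : ℝ) < d1 := by exact_mod_cast hd
  have hm' : (0 : ℝ) < m := by exact_mod_cast hm
  have hs' : (0 : ℝ) < s := by exact_mod_cast hs
  have hv1 : nsq v = 1 := by
    have : Real.sqrt (nsq v) = 1 := hv
    exact Real.sqrt_eq_one.1 this
  obtain ⟨p, hp⟩ : ∃ p : ℝ, p = (d2 : ℝ) / d1 := ⟨_, rfl⟩
  have hp0 : 0 < p := by rw [hp]; positivity
  have hp1 : p < 1 := by rw [hp, div_lt_one hd1']; exact hdlt
  have hpd : p * d1 = d2 := by rw [hp]; field_simp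
  let χ : Fin d1 → ℝ := fun j => if j.val / d2 = i then (1 : ℝ) else 0
  have hχ : ∑ j, χ j = d2 := block_sum d1 d2 i hd2 hdvd hi
  have hχ2 : ∀ j, χ j ^ 2 = χ j := by intro j; simp only [χ]; split_ifs <;> norm_num
  let X : (Fin d1 → ℂ) → ℝ := fun w => ∑ j, χ j * ‖w j‖ ^ 2
  have hX0 : ∀ w, 0 ≤ X w := fun w => Finset.sum_nonneg fun j _ => by
    simp only [χ]; split_ifs <;> positivity
  have hl2 : ∀ w, l2norm ((blockProj d1 d2 i).mulVec w) = Real.sqrt (X w) := by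
    intro w
    simp only [l2norm, X, blockProj, Matrix.mulVec_diagonal]
    congr 1
    refine Finset.sum_congr rfl fun j _ => ?_
    simp only [χ]
    split_ifs <;> simp
  -- linear forms in the X variable
  have hlin : ∀ (c e : ℝ) (U : Matrix.unitaryGroup (Fin d1) ℂ),
      ∑ j, (c + e * χ j) * ‖((U : Matrix (Fin d1) (Fin d1) ℂ) *ᵥ v) j‖ ^ 2 =
        c + e * X ((U : Matrix (Fin d1) (Fin d1) ℂ) *ᵥ v) := by
    intro c e U
    have h1 := nsq_unitary U v
    rw [hv1, nsq] at h1
    simp only [add_mul, Finset.sum_add_distrib, ← Finset.mul_sum, h1, X, mul_assoc, mul_one]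
  have hsq : ∀ c e : ℝ, ∑ j, (c + e * χ j) ^ 2 = c ^ 2 * d1 + 2 * c * e * d2 + e ^ 2 * d2 := by
    intro c e
    have : ∀ j, (c + e * χ j) ^ 2 = c ^ 2 + (2 * c * e + e ^ 2) * χ j := by
      intro j
      calc (c + e * χ j) ^ 2 = c ^ 2 + 2 * c * e * χ j + e ^ 2 * χ j ^ 2 := by ring
        _ = _ := by rw [hχ2]; ring
    simp only [this, Finset.sum_add_distrib, ← Finset.mul_sum, hχ]
    simp
    ring
  have hmom : ∀ c e : ℝ, (∑ k, (c + e * X ((V k : Matrix (Fin d1) (Fin d1) ℂ) *ᵥ v)) ^ (2 * m)) / s ≤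
      ∫ U, (c + e * X ((U : Matrix (Fin d1) (Fin d1) ℂ) *ᵥ v)) ^ (2 * m) ∂μ +
        lam * (c ^ 2 * d1 + 2 * c * e * d2 + e ^ 2 * d2) ^ m := by
    intro c e
    have := tpe_moment μ s V lam m hV v hv1 (fun j => c + e * χ j)
    simp only [hlin, hsq] at this
    exact this
  have hinteg : ∀ c e : ℝ, Integrable (fun U : Matrix.unitaryGroup (Fin d1) ℂ =>
      (c + e * X ((U : Matrix (Fin d1) (Fin d1) ℂ) *ᵥ v)) ^ (2 * m)) μ := by
    intro c e
    have := integ_quad μ v hv1 (fun j => c + e * χ j) (2 * m)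
    simp only [hlin] at this
    exact this
  -- the Haar moment
  obtain ⟨K, hKdef⟩ : ∃ K : ℝ, K = ∫ U, (-p + 1 * X ((U : Matrix (Fin d1) (Fin d1) ℂ) *ᵥ v)) ^ (2 * m) ∂μ :=
    ⟨_, rfl⟩
  have hmd : (m : ℝ) / d2 = ε ^ 2 / 2 ^ 10 := by rw [hmval]; field_simp
  have hK : K ≤ 2 * (Real.exp 2 * ε ^ 2 * p ^ 2 / 256) ^ m := by
    have ht2 : Real.sqrt (m / d2) ^ 2 = m / d2 := Real.sq_sqrt (by positivity)
    have h := haar_moment μ hinv hd1 v hv1 (fun j => -p + 1 * χ j)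
      (by simp only [Finset.sum_add_distrib, one_mul, hχ]; simp; linarith)
      (by
        intro j
        simp only [χ]
        split_ifs <;> rw [abs_le] <;> constructor <;> linarith) m hm d2 (Real.sqrt (m / d2))
      (by rw [hsq]; nlinarith)
      (Real.sqrt_pos.2 (by positivity))
      (by
        rw [hmd]
        apply Real.sqrt_le_iff.2
        constructor
        · norm_num
        · nlinarith)
    simp only [hlin] at h
    rw [← hKdef] at h
    refine h.trans ?_
    have hf : ((2 * m).factorial : ℝ) ≤ (2 * m : ℝ) ^ (2 * m) := by
      exact_mod_cast Nat.factorial_le_pow (2 * m)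
    have hexp : Real.exp (2 * Real.sqrt (m / d2) ^ 2 * d2) = (Real.exp 2) ^ m := by
      rw [ht2, ← Real.exp_nat_mul]
      congr 1; field_simp
    rw [hexp, pow_mul (Real.sqrt _), ht2, pow_mul (d1 : ℝ)]
    calc 2 * (((2 * m).factorial : ℝ) / (m / d2) ^ m) * Real.exp 2 ^ m / ((d1 : ℝ) ^ 2) ^ m
        ≤ 2 * ((2 * m : ℝ) ^ (2 * m) / (m / d2) ^ m) * Real.exp 2 ^ m / ((d1 : ℝ) ^ 2) ^ m := by
          gcongr
      _ = 2 * ((2 * m : ℝ) ^ 2 / (m / d2) * Real.exp 2 / (d1 : ℝ) ^ 2) ^ m := by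
          rw [pow_mul (2 * m : ℝ)]
          simp only [div_pow, mul_pow]
          ring
      _ = _ := by
          congr 2
          have : (m : ℝ) * 2 ^ 10 = ε ^ 2 * d2 := by rw [hmval]; field_simp
          rw [hp]
          field_simp
          nlinarith
  -- bound for lam
  have hlam' : ∀ Q R : ℝ, 0 ≤ Q → 4 * ε ^ 2 * d2 / (d1 : ℝ) ^ 2 * Q ≤ R →
      lam * Q ^ m ≤ R ^ m * Real.exp (-(m : ℝ)) := by
    intro Q R hQ hQR
    calc lam * Q ^ m ≤ ((4 * ε ^ 2 * d2 / (d1 : ℝ) ^ 2) ^ m * Real.exp (-(m : ℝ))) * Q ^ m := by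
          gcongr
      _ = (4 * ε ^ 2 * d2 / (d1 : ℝ) ^ 2 * Q) ^ m * Real.exp (-(m : ℝ)) := by
          rw [mul_pow _ Q]; ring
      _ ≤ _ := by gcongr
  have hsqp : Real.sqrt p ^ 2 = p := Real.sq_sqrt hp0.le
  have hsp : 0 ≤ Real.sqrt p := Real.sqrt_nonneg p
  have he3 := exp_three
  -- upper tail
  have hup : ((Finset.univ.filter fun k : Fin s => (1 + ε) * Real.sqrt p <
      Real.sqrt (X ((V k : Matrix (Fin d1) (Fin d1) ℂ) *ᵥ v))).card : ℝ) / s ≤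
      3 * Real.exp (-(m : ℝ)) := by
    have h1 := markov_count (fun k : Fin s => (1 + ε) * Real.sqrt p <
      Real.sqrt (X ((V k : Matrix (Fin d1) (Fin d1) ℂ) *ᵥ v)))
      (fun k => -p + 1 * X ((V k : Matrix (Fin d1) (Fin d1) ℂ) *ᵥ v)) (2 * ε * p) m (by positivity)
      (by
        intro k hk
        refine le_trans ?_ (le_abs_self _)
        have hx := Real.sq_sqrt (hX0 ((V k : Matrix (Fin d1) (Fin d1) ℂ) *ᵥ v))
        have : ((1 + ε) * Real.sqrt p) ^ 2 ≤
          Real.sqrt (X ((V k : Matrix (Fin d1) (Fin d1) ℂ) *ᵥ v)) ^ 2 := by gcongr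
        rw [hx, mul_pow, hsqp] at this
        nlinarith [mul_pos (mul_pos hε hε) hp0])
    have h2 := hmom (-p) 1
    rw [← hKdef] at h2
    have h3 := hlam' ((-p) ^ 2 * d1 + 2 * (-p) * 1 * d2 + 1 ^ 2 * d2) ((2 * ε * p) ^ 2)
      (by nlinarith) (by
        have : (-p) ^ 2 * d1 + 2 * (-p) * 1 * d2 + 1 ^ 2 * d2 ≤ d2 := by nlinarith
        calc _ ≤ 4 * ε ^ 2 * d2 / (d1 : ℝ) ^ 2 * d2 := by gcongr
          _ = _ := by rw [hp]; field_simp; ring)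
    have h4 := pow_exp_le (Real.exp 2 * ε ^ 2 * p ^ 2 / 256) ((2 * ε * p) ^ 2) m (by positivity)
      (by
        have : 0 ≤ ε ^ 2 * p ^ 2 := by positivity
        nlinarith)
    have hc : 0 < ((2 * ε * p) ^ 2) ^ m := by positivity
    apply le_of_mul_le_mul_right _ hc
    exact arith_up h1 h2 h3 hK h4
  -- lower tail
  obtain ⟨u, hu⟩ : ∃ u : ℝ, u = 1 / (1 + ε ^ 2) := ⟨_, rfl⟩
  have hu0 : 0 < u := by rw [hu]; positivity
  have hu1 : u * (1 + ε ^ 2) = 1 := by rw [hu]; field_simp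
  have hu2 : 1 ≤ 2 * u := by
    have : ε ^ 2 < 1 := by nlinarith
    nlinarith
  have hlow : ((Finset.univ.filter fun k : Fin s =>
      Real.sqrt (X ((V k : Matrix (Fin d1) (Fin d1) ℂ) *ᵥ v)) < (1 - ε) * Real.sqrt p).card : ℝ) / s ≤
      4 * Real.exp (-(m : ℝ)) := by
    have h1 := markov_count (fun k : Fin s =>
      Real.sqrt (X ((V k : Matrix (Fin d1) (Fin d1) ℂ) *ᵥ v)) < (1 - ε) * Real.sqrt p)
      (fun k => 1 + (-(u / p)) * X ((V k : Matrix (Fin d1) (Fin d1) ℂ) *ᵥ v)) (2 * ε * u) m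
      (by positivity)
      (by
        intro k hk
        refine le_trans ?_ (le_abs_self _)
        have hx := Real.sq_sqrt (hX0 ((V k : Matrix (Fin d1) (Fin d1) ℂ) *ᵥ v))
        have : Real.sqrt (X ((V k : Matrix (Fin d1) (Fin d1) ℂ) *ᵥ v)) ^ 2 ≤
          ((1 - ε) * Real.sqrt p) ^ 2 := by gcongr
        rw [hx, mul_pow, hsqp] at this
        have h5 := mul_le_mul_of_nonneg_left this (by positivity : 0 ≤ u / p)
        have h6 : u / p * ((1 - ε) ^ 2 * p) = u * (1 - ε) ^ 2 := by field_simp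
        rw [h6] at h5
        nlinarith)
    have h2 := hmom 1 (-(u / p))
    have h3 := hlam' (1 ^ 2 * d1 + 2 * 1 * (-(u / p)) * d2 + (-(u / p)) ^ 2 * d2) ((2 * ε * u) ^ 2)
      (by
        rw [← hsq]; exact Finset.sum_nonneg fun _ _ => sq_nonneg _) (by
        have e1 : u / p * d2 = u * d1 := by rw [hp]; field_simp
        have : (1 : ℝ) ^ 2 * d1 + 2 * 1 * (-(u / p)) * d2 + (-(u / p)) ^ 2 * d2 ≤
          (u / p) ^ 2 * d2 := by nlinarith
        calc _ ≤ 4 * ε ^ 2 * d2 / (d1 : ℝ) ^ 2 * ((u / p) ^ 2 * d2) := by gcongr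
          _ = _ := by rw [hp]; field_simp; ring)
    have hH : ∫ U, (1 + (-(u / p)) * X ((U : Matrix (Fin d1) (Fin d1) ℂ) *ᵥ v)) ^ (2 * m) ∂μ ≤
        (36 / 25 * (1 - u) ^ 2) ^ m + (36 * (u / p) ^ 2) ^ m * K := by
      calc _ ≤ ∫ U, ((36 / 25 * (1 - u) ^ 2) ^ m + (36 * (u / p) ^ 2) ^ m *
            (-p + 1 * X ((U : Matrix (Fin d1) (Fin d1) ℂ) *ᵥ v)) ^ (2 * m)) ∂μ := by
            apply integral_mono (hinteg _ _) ((integrable_const _).add ((hinteg _ _).const_mul _))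
            intro U
            simp only
            have h7 := cvx (1 - u)
              (-(u / p) * (-p + 1 * X ((U : Matrix (Fin d1) (Fin d1) ℂ) *ᵥ v))) m
            have e1 : (1 - u) + (-(u / p) * (-p + 1 * X ((U : Matrix (Fin d1) (Fin d1) ℂ) *ᵥ v)))
              = 1 + (-(u / p)) * X ((U : Matrix (Fin d1) (Fin d1) ℂ) *ᵥ v) := by
              field_simp; ring
            rw [e1] at h7
            refine h7.trans (le_of_eq ?_)
            change _ = (36 / 25 * (1 - u) ^ 2) ^ m + (36 * (u / p) ^ 2) ^ m *
              (-p + 1 * X ((U : Matrix (Fin d1) (Fin d1) ℂ) *ᵥ v)) ^ (2 * m)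
            rw [pow_mul (-p + 1 * X ((U : Matrix (Fin d1) (Fin d1) ℂ) *ᵥ v)), ← mul_pow]
            congr 2; ring
        _ = _ := by
            rw [integral_add (integrable_const _) ((hinteg _ _).const_mul _),
              integral_const_mul, ← hKdef]
            simp
    have hK2 : (36 * (u / p) ^ 2) ^ m * K ≤ 2 * (36 * u ^ 2 * (Real.exp 2 * ε ^ 2 / 256)) ^ m := by
      calc _ ≤ (36 * (u / p) ^ 2) ^ m * (2 * (Real.exp 2 * ε ^ 2 * p ^ 2 / 256) ^ m) := by gcongr
        _ = 2 * (36 * (u / p) ^ 2 * (Real.exp 2 * ε ^ 2 * p ^ 2 / 256)) ^ m := by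
            rw [mul_pow (36 * (u / p) ^ 2)]; ring
        _ = _ := by congr 2; field_simp
    have h4 := pow_exp_le (36 * u ^ 2 * (Real.exp 2 * ε ^ 2 / 256)) ((2 * ε * u) ^ 2) m
      (by positivity)
      (by
        have : 0 ≤ ε ^ 2 * u ^ 2 := by positivity
        nlinarith)
    have h5 := pow_exp_le (36 / 25 * (1 - u) ^ 2) ((2 * ε * u) ^ 2) m (by positivity)
      (by
        have e1 : 1 - u = ε ^ 2 * u := by linarith
        rw [e1]
        have he := Real.exp_one_lt_d9
        have hee : Real.exp 1 ≤ 2.72 := by linarith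
        have h9 : ε ^ 2 ≤ 1 := by nlinarith
        calc 36 / 25 * (ε ^ 2 * u) ^ 2 * Real.exp 1
            = 36 / 25 * (ε ^ 2 * u ^ 2) * ε ^ 2 * Real.exp 1 := by ring
          _ ≤ 36 / 25 * (ε ^ 2 * u ^ 2) * 1 * 2.72 := by gcongr
          _ ≤ _ := by
            have : 0 ≤ ε ^ 2 * u ^ 2 := by positivity
            nlinarith)
    have hc : 0 < ((2 * ε * u) ^ 2) ^ m := by positivity
    apply le_of_mul_le_mul_right _ hc
    linarith
  have hfin : Real.exp (-(ε ^ 2 * d2) / 2 ^ 10) = Real.exp (-(m : ℝ)) := by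
    rw [hmval]; congr 1; ring
  rw [hfin]
  simp only [hl2]
  rw [← hp]
  have hcard : ((Finset.univ.filter fun k : Fin s =>
        ¬((1 - ε) * Real.sqrt p ≤ Real.sqrt (X ((V k : Matrix (Fin d1) (Fin d1) ℂ) *ᵥ v)) ∧
          Real.sqrt (X ((V k : Matrix (Fin d1) (Fin d1) ℂ) *ᵥ v)) ≤ (1 + ε) * Real.sqrt p)).card : ℝ)
      ≤ ((Finset.univ.filter fun k : Fin s =>
      Real.sqrt (X ((V k : Matrix (Fin d1) (Fin d1) ℂ) *ᵥ v)) < (1 - ε) * Real.sqrt p).card : ℝ) +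
      ((Finset.univ.filter fun k : Fin s => (1 + ε) * Real.sqrt p <
      Real.sqrt (X ((V k : Matrix (Fin d1) (Fin d1) ℂ) *ᵥ v))).card : ℝ) := by
    rw [← Nat.cast_add]
    apply Nat.cast_le.2
    refine le_trans (Finset.card_le_card ?_) (Finset.card_union_le _ _)
    intro k hk
    simp only [Finset.mem_filter, Finset.mem_univ, true_and, Finset.mem_union] at hk ⊢
    rw [not_and_or, not_le, not_le] at hk
    exact hk
  have hdiv := div_le_div_of_nonneg_right hcard hs'.le
  rw [add_div] at hdiv
  have := Real.exp_pos (-(m : ℝ))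
  linarith
end
end

section
/- Let $0 < \epsilon < 1/4$, let $d_2 < d_1$ with $d_2$ dividing $d_1$, and let $u_1, u_2 \in \mathbb{C}^{d_1}$ be unit vectors. Let $U$ be a $d_1 \times d_1$ unitary matrix and $\Pi$ a block projection such that: (i) $\|\Pi U u_k\|_2 \in [(1-\epsilon)\sqrt{d_2/d_1}, (1+\epsilon)\sqrt{d_2/d_1}]$ for $k = 1, 2$; (ii) $\|\Pi U (u_1 - u_2)\|_2 \in [(1-\epsilon)\|u_1 - u_2\|_2\sqrt{d_2/d_1}, (1+\epsilon)\|u_1 - u_2\|_2\sqrt{d_2/d_1}]$; and (iii) $\|\Pi U (u_1 - \sqrt{-1}\, u_2)\|_2 \in [(1-\epsilon)\|u_1 - \sqrt{-1}\, u_2\|_2\sqrt{d_2/d_1}, (1+\epsilon)\|u_1 - \sqrt{-1}\, u_2\|_2\sqrt{d_2/d_1}]$. Define the normalized projected vectors $w_k := \frac{\Pi U u_k}{\|\Pi U u_k\|_2}$ for $k = 1, 2$. Then both the real part and the imaginary part of $\langle w_1, w_2 \rangle - \langle u_1, u_2 \rangle$ have absolute value at most $8\epsilon$. -/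
open Matrix

noncomputable section

/-- The standard Hermitian inner product on `ℂ^d`, conjugate-linear in the first argument. -/
def hinner {d : ℕ} (u w : Fin d → ℂ) : ℂ := ∑ a, (starRingEnd ℂ) (u a) * w a

lemma ipp_core (ε s n1 n2 m D r x : ℝ) (hε : 0 < ε) (hε1 : ε < 1 / 4) (hs : 0 < s)
    (a1 : (1 - ε) * s ≤ n1) (b1 : n1 ≤ (1 + ε) * s)
    (a2 : (1 - ε) * s ≤ n2) (b2 : n2 ≤ (1 + ε) * s)
    (hD : 0 ≤ D) (a3 : (1 - ε) * D * s ≤ m) (b3 : m ≤ (1 + ε) * D * s)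
    (hm : m ^ 2 = n1 ^ 2 + n2 ^ 2 - 2 * (x * (n1 * n2)))
    (hD2 : D ^ 2 = 2 - 2 * r) (hr : |r| ≤ 1) (hx : |x| ≤ 1) : |x - r| ≤ 8 * ε := by
  rw [abs_le] at hr hx
  have hl : 0 < (1 - ε) * s := mul_pos (by linarith) hs
  have hs2 : 0 < s ^ 2 := by positivity
  have N1 : ((1 - ε) * s) * ((1 - ε) * s) ≤ n1 * n2 :=
    mul_le_mul a1 a2 hl.le (by linarith)
  have N2 : n1 * n2 ≤ ((1 + ε) * s) * ((1 + ε) * s) :=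
    mul_le_mul b1 b2 (by linarith) (by positivity)
  have hm0 : 0 ≤ (1 - ε) * D * s := mul_nonneg (mul_nonneg (by linarith) hD) hs.le
  have M1 : ((1 - ε) * D * s) ^ 2 ≤ m ^ 2 := pow_le_pow_left₀ hm0 a3 2
  have M2 : m ^ 2 ≤ ((1 + ε) * D * s) ^ 2 := pow_le_pow_left₀ (by linarith) b3 2
  have K : (n1 - n2) ^ 2 ≤ (2 * ε * s) ^ 2 := by
    apply sq_le_sq' <;> linarith
  have t0 : 0 ≤ 1 - x := by linarith
  have T1 := mul_le_mul_of_nonneg_right N1 t0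
  have T2 := mul_le_mul_of_nonneg_right N2 t0
  have E1 : ((1 - ε) * D * s) ^ 2 = s ^ 2 * ((1 - ε) ^ 2 * (2 - 2 * r)) := by rw [← hD2]; ring
  have E2 : ((1 + ε) * D * s) ^ 2 = s ^ 2 * ((1 + ε) ^ 2 * (2 - 2 * r)) := by rw [← hD2]; ring
  have L : (1 - ε) ^ 2 * (1 - x) ≤ (1 + ε) ^ 2 * (1 - r) := by
    refine le_of_mul_le_mul_left ?_ hs2
    nlinarith [sq_nonneg (n1 - n2)]
  have R : (1 - ε) ^ 2 * (1 - r) - 2 * ε ^ 2 ≤ (1 + ε) ^ 2 * (1 - x) := by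
    refine le_of_mul_le_mul_left ?_ hs2
    nlinarith
  have hq : 0 < (1 + ε) ^ 2 := by positivity
  have e3 : 0 < ε ^ 3 := by positivity
  rw [abs_le]
  constructor
  · refine le_of_mul_le_mul_left ?_ hq
    have := mul_le_mul_of_nonneg_left (show 1 - x ≤ 2 by linarith) hε.le
    nlinarith
  · refine le_of_mul_le_mul_left ?_ hq
    have := mul_le_mul_of_nonneg_left (show 1 - r ≤ 2 by linarith) hε.le
    nlinarith

lemma ipp_norm {d : ℕ} (v : Fin d → ℂ) : l2norm v = ‖WithLp.toLp 2 v‖ := by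
  simp [l2norm, EuclideanSpace.norm_eq]

lemma ipp_inner {d : ℕ} (v w : Fin d → ℂ) :
    hinner v w = inner ℂ (WithLp.toLp 2 v) (WithLp.toLp 2 w) := by
  simp [hinner, PiLp.inner_apply, mul_comm]

lemma ipp_sub {d : ℕ} (v w : Fin d → ℂ) :
    l2norm (v - w) ^ 2 = l2norm v ^ 2 + l2norm w ^ 2 - 2 * (hinner v w).re := by
  have := @norm_sub_sq ℂ _ _ _ _ (WithLp.toLp 2 v) (WithLp.toLp 2 w)
  rw [ipp_norm, ipp_norm, ipp_norm, ipp_inner, WithLp.toLp_sub, this, RCLike.re_eq_complex_re]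
  ring

lemma ipp_cs {d : ℕ} (v w : Fin d → ℂ) : |(hinner v w).re| ≤ l2norm v * l2norm w := by
  rw [ipp_norm, ipp_norm, ipp_inner]
  exact (Complex.abs_re_le_norm _).trans (norm_inner_le_norm _ _)

lemma ipp_smul {d : ℕ} (a b : ℝ) (v w : Fin d → ℂ) :
    hinner (a • v) (b • w) = ((a * b : ℝ) : ℂ) * hinner v w := by
  simp only [hinner, Finset.mul_sum]
  refine Finset.sum_congr rfl fun i _ => ?_
  simp
  ring

lemma ipp_I {d : ℕ} (v w : Fin d → ℂ) :
    hinner v (Complex.I • w) = Complex.I * hinner v w := by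
  simp only [hinner, Finset.mul_sum]
  refine Finset.sum_congr rfl fun i _ => ?_
  simp
  ring

lemma ipp_normI {d : ℕ} (w : Fin d → ℂ) : l2norm (Complex.I • w) = l2norm w := by
  simp [l2norm]

lemma ipp_real {d : ℕ} (ε s : ℝ) (hε : 0 < ε) (hε1 : ε < 1 / 4) (hs : 0 < s)
    (u v p q : Fin d → ℂ) (hu : l2norm u = 1) (hv : l2norm v = 1)
    (h1 : (1 - ε) * s ≤ l2norm p ∧ l2norm p ≤ (1 + ε) * s)
    (h2 : (1 - ε) * s ≤ l2norm q ∧ l2norm q ≤ (1 + ε) * s)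
    (h3 : (1 - ε) * l2norm (u - v) * s ≤ l2norm (p - q) ∧
      l2norm (p - q) ≤ (1 + ε) * l2norm (u - v) * s) :
    |(hinner ((l2norm p)⁻¹ • p) ((l2norm q)⁻¹ • q) - hinner u v).re| ≤ 8 * ε := by
  have hl : 0 < (1 - ε) * s := mul_pos (by linarith) hs
  have hp : 0 < l2norm p := by linarith
  have hq : 0 < l2norm q := by linarith
  have hpq := mul_pos hp hq
  have e : (hinner ((l2norm p)⁻¹ • p) ((l2norm q)⁻¹ • q)).re
      = (hinner p q).re / (l2norm p * l2norm q) := by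
    rw [ipp_smul, Complex.re_ofReal_mul]
    field_simp
  rw [Complex.sub_re, e]
  refine ipp_core ε s _ _ _ (l2norm (u - v)) _ _ hε hε1 hs h1.1 h1.2 h2.1 h2.2
    (Real.sqrt_nonneg _) h3.1 h3.2 ?_ ?_ ?_ ?_
  · rw [ipp_sub, div_mul_cancel₀ _ hpq.ne']
  · rw [ipp_sub, hu, hv]; ring
  · simpa [hu, hv] using ipp_cs u v
  · rw [abs_div, abs_of_pos hpq, div_le_one hpq]
    exact ipp_cs p q

/-- **Norm preservation implies inner-product preservation:** if a unitary `U` and a block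
projection `Π` preserve (up to `1 ± ε`) the norms of the unit vectors `u₁, u₂`, of
`u₁ - u₂`, and of `u₁ - √-1 u₂` (each scaled by `√(d₂/d₁)`), then the inner product of the
normalized projected vectors `wₖ = Π U uₖ / ‖Π U uₖ‖₂` differs from `⟨u₁, u₂⟩` by at most
`8ε` in both its real and imaginary parts. -/
theorem inner_product_preservation
    (d1 d2 : ℕ) (hd : d2 < d1) (hdvd : d2 ∣ d1)
    (ε : ℝ) (hε : 0 < ε) (hε1 : ε < 1 / 4)
    (u1 u2 : Fin d1 → ℂ) (hu1 : l2norm u1 = 1) (hu2 : l2norm u2 = 1)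
    (U : Matrix.unitaryGroup (Fin d1) ℂ)
    (j : ℕ) (hj : j < d1 / d2)
    -- abbreviations for the projected vectors
    (p1 p2 p12 p12I : Fin d1 → ℂ)
    (hp1 : p1 = (blockProj d1 d2 j).mulVec ((U : Matrix (Fin d1) (Fin d1) ℂ).mulVec u1))
    (hp2 : p2 = (blockProj d1 d2 j).mulVec ((U : Matrix (Fin d1) (Fin d1) ℂ).mulVec u2))
    (hp12 : p12 =
      (blockProj d1 d2 j).mulVec ((U : Matrix (Fin d1) (Fin d1) ℂ).mulVec (u1 - u2)))
    (hp12I : p12I =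
      (blockProj d1 d2 j).mulVec
        ((U : Matrix (Fin d1) (Fin d1) ℂ).mulVec (u1 - Complex.I • u2)))
    -- (i) norms of the two vectors are preserved
    (h1 : (1 - ε) * Real.sqrt ((d2 : ℝ) / d1) ≤ l2norm p1 ∧
          l2norm p1 ≤ (1 + ε) * Real.sqrt ((d2 : ℝ) / d1))
    (h2 : (1 - ε) * Real.sqrt ((d2 : ℝ) / d1) ≤ l2norm p2 ∧
          l2norm p2 ≤ (1 + ε) * Real.sqrt ((d2 : ℝ) / d1))
    -- (ii) norm of the difference is preserved
    (h12 : (1 - ε) * l2norm (u1 - u2) * Real.sqrt ((d2 : ℝ) / d1) ≤ l2norm p12 ∧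
           l2norm p12 ≤ (1 + ε) * l2norm (u1 - u2) * Real.sqrt ((d2 : ℝ) / d1))
    -- (iii) norm of the twisted difference is preserved
    (h12I : (1 - ε) * l2norm (u1 - Complex.I • u2) * Real.sqrt ((d2 : ℝ) / d1)
              ≤ l2norm p12I ∧
            l2norm p12I ≤ (1 + ε) * l2norm (u1 - Complex.I • u2) * Real.sqrt ((d2 : ℝ) / d1))
    -- normalized projected vectors
    (w1 w2 : Fin d1 → ℂ)
    (hw1 : w1 = (l2norm p1)⁻¹ • p1) (hw2 : w2 = (l2norm p2)⁻¹ • p2) :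
    |(hinner w1 w2 - hinner u1 u2).re| ≤ 8 * ε ∧
    |(hinner w1 w2 - hinner u1 u2).im| ≤ 8 * ε := by
  have hd2 : 0 < d2 := by
    rcases Nat.eq_zero_or_pos d2 with h | h
    · subst h; simp at hj
    · exact h
  have hs : 0 < Real.sqrt ((d2 : ℝ) / d1) := by
    have : 0 < d1 := by omega
    positivity
  have e1 : p12 = p1 - p2 := by
    rw [hp12, hp1, hp2, Matrix.mulVec_sub, Matrix.mulVec_sub]
  have e2 : p12I = p1 - Complex.I • p2 := by
    rw [hp12I, hp1, hp2, Matrix.mulVec_sub, Matrix.mulVec_sub, Matrix.mulVec_smul,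
      Matrix.mulVec_smul]
  rw [e1] at h12
  rw [e2] at h12I
  rw [hw1, hw2]
  refine ⟨ipp_real ε _ hε hε1 hs u1 u2 p1 p2 hu1 hu2 h1 h2 h12, ?_⟩
  have := ipp_real ε _ hε hε1 hs u1 (Complex.I • u2) p1 (Complex.I • p2) hu1
    (by rw [ipp_normI, hu2]) h1 (by rw [ipp_normI]; exact h2) h12I
  rw [ipp_normI, smul_comm, ipp_I, ipp_I, ← mul_sub, Complex.I_mul_re, abs_neg] at this
  exact this
end
end
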